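/- arXiv:2509.01872 — 8 statements merged into one kernel-verified Lean document; each statement's English description precedes it below -/
import Mathlib

section
/- Let X and Y be real Banach spaces and let A : X ⇒ Y be a set-valued mapping with A(0) ≠ ∅. Then A is compactly R-continuous at 0 and A(0) is a closed set if and only if the graph of A is closed at the domain point 0, i.e., for any sequence x_k → 0 and any y_k ∈ A(x_k) with y_k → y, one has y ∈ A(0). -/
open Filter Set

/-- `A` is R-continuous at `x₀`: there exist a radius `σ > 0` and a nonnegative,
nondecreasing modulus function `ρ` with `ρ 0 = 0` and `ρ r → 0` as `r → 0⁺` such that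
every `y ∈ A x` with `‖x - x₀‖ ≤ σ` lies within `ρ ‖x - x₀‖` of some point of `A x₀`. -/
def RContinuousAt {X Y : Type*} [NormedAddCommGroup X] [NormedAddCommGroup Y]
    (A : X → Set Y) (x₀ : X) : Prop :=
  ∃ σ > (0 : ℝ), ∃ ρ : ℝ → ℝ,
    (∀ r, 0 ≤ r → 0 ≤ ρ r) ∧
    (∀ r s, 0 ≤ r → r ≤ s → ρ r ≤ ρ s) ∧
    ρ 0 = 0 ∧
    Tendsto ρ (nhdsWithin 0 (Ioi 0)) (nhds 0) ∧
    ∀ x : X, ‖x - x₀‖ ≤ σ → ∀ y ∈ A x, ∃ ybar ∈ A x₀, ‖y - ybar‖ ≤ ρ ‖x - x₀‖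

/-- `A` is compactly R-continuous at `x₀`: for every compact `K`, the R-continuity
estimate holds for points `y ∈ A x ∩ K`. -/
def CompactRContinuousAt {X Y : Type*} [NormedAddCommGroup X] [NormedAddCommGroup Y]
    (A : X → Set Y) (x₀ : X) : Prop :=
  ∀ K : Set Y, IsCompact K →
    ∃ σ > (0 : ℝ), ∃ ρ : ℝ → ℝ,
      (∀ r, 0 ≤ r → 0 ≤ ρ r) ∧
      (∀ r s, 0 ≤ r → r ≤ s → ρ r ≤ ρ s) ∧
      ρ 0 = 0 ∧
      Tendsto ρ (nhdsWithin 0 (Ioi 0)) (nhds 0) ∧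
      ∀ x : X, ‖x - x₀‖ ≤ σ → ∀ y ∈ A x ∩ K, ∃ ybar ∈ A x₀, ‖y - ybar‖ ≤ ρ ‖x - x₀‖

open Metric Topology

section

variable {X Y : Type*} [NormedAddCommGroup X] [NormedAddCommGroup Y] {A : X → Set Y}

theorem CompactRContinuousAt.mem_of_tendsto {x₀ : X} (hA : CompactRContinuousAt A x₀)
    (hcl : IsClosed (A x₀)) {x : ℕ → X} {y : ℕ → Y} {z : Y} (hx : Tendsto x atTop (𝓝 x₀))
    (hxy : ∀ k, y k ∈ A (x k)) (hy : Tendsto y atTop (𝓝 z)) : z ∈ A x₀ := by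
  obtain ⟨σ, hσ, ρ, -, -, hρ0, hρ, h⟩ := hA _ hy.isCompact_insert_range
  have hnorm : Tendsto (fun k => ‖x k - x₀‖) atTop (𝓝 0) := tendsto_iff_norm_sub_tendsto_zero.1 hx
  rw [← hcl.closure_eq, Metric.mem_closure_iff]
  intro ε hε
  have hρlt : ∀ᶠ k in atTop, ρ ‖x k - x₀‖ < ε / 2 := by
    have h₁ : ∀ᶠ r in 𝓝 (0 : ℝ), r ∈ Ioi (0 : ℝ) → ρ r < ε / 2 :=
      eventually_nhdsWithin_iff.1 (hρ.eventually_lt_const (half_pos hε))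
    filter_upwards [hnorm.eventually h₁] with k hk
    rcases (norm_nonneg (x k - x₀)).eq_or_lt with h0 | h0
    · rw [← h0, hρ0]
      exact half_pos hε
    · exact hk h0
  obtain ⟨k, hkσ, hkρ, hkz⟩ := ((hnorm.eventually_lt_const hσ).and
    (hρlt.and (Metric.tendsto_nhds.1 hy _ (half_pos hε)))).exists
  obtain ⟨w, hw, hyw⟩ := h (x k) hkσ.le (y k) ⟨hxy k, mem_insert_of_mem _ (mem_range_self k)⟩
  refine ⟨w, hw, ?_⟩
  rw [← dist_eq_norm] at hyw
  linarith [dist_triangle_left z w (y k)]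

theorem exists_pos_forall_infDist_le {x₀ : X}
    (hA : ∀ (x : ℕ → X) (y : ℕ → Y) (z : Y), Tendsto x atTop (𝓝 x₀) → (∀ k, y k ∈ A (x k)) →
      Tendsto y atTop (𝓝 z) → z ∈ A x₀)
    {K : Set Y} (hK : IsCompact K) {ε : ℝ} (hε : 0 < ε) :
    ∃ δ > 0, ∀ x, ‖x - x₀‖ < δ → ∀ y ∈ A x ∩ K, infDist y (A x₀) ≤ ε := by
  by_contra! hcon
  choose x hx y hy hyε using fun n : ℕ => hcon (1 / ((n : ℝ) + 1)) Nat.one_div_pos_of_nat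
  obtain ⟨z, -, φ, hφ, hz⟩ := hK.tendsto_subseq fun n => (hy n).2
  have hx₀ : Tendsto x atTop (𝓝 x₀) := tendsto_iff_norm_sub_tendsto_zero.2 <|
    squeeze_zero (fun _ => norm_nonneg _) (fun n => (hx n).le) tendsto_one_div_add_atTop_nhds_zero_nat
  have hzA : z ∈ A x₀ := hA (x ∘ φ) (y ∘ φ) z (hx₀.comp hφ.tendsto_atTop) (fun k => (hy _).1) hz
  have hle : ε ≤ infDist z (A x₀) :=
    ge_of_tendsto' (((continuous_infDist_pt (A x₀)).tendsto z).comp hz) fun k => (hyε _).le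
  rw [infDist_zero_of_mem hzA] at hle
  exact hle.not_gt hε

theorem compactRContinuousAt_of_graph_closed {x₀ : X} (hne : (A x₀).Nonempty)
    (hA : ∀ (x : ℕ → X) (y : ℕ → Y) (z : Y), Tendsto x atTop (𝓝 x₀) → (∀ k, y k ∈ A (x k)) →
      Tendsto y atTop (𝓝 z) → z ∈ A x₀)
    (hcl : IsClosed (A x₀)) : CompactRContinuousAt A x₀ := by
  intro K hK
  obtain ⟨M, hM⟩ := (hK.image (continuous_infDist_pt (A x₀))).bddAbove
  -- `S r` collects the distances to `A x₀` attained over the closed ball of radius `r`;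
  -- `0` is inserted so that it is never empty.
  let S : ℝ → Set ℝ := fun r =>
    insert 0 {d | ∃ x, ‖x - x₀‖ ≤ r ∧ ∃ y ∈ A x ∩ K, infDist y (A x₀) = d}
  have hS0 : ∀ r, (0 : ℝ) ∈ S r := fun r => mem_insert _ _
  have hSbdd : ∀ r, BddAbove (S r) := fun r => by
    refine BddAbove.insert 0 ⟨M, ?_⟩
    rintro _ ⟨x, -, y, hy, rfl⟩
    exact hM (mem_image_of_mem _ hy.2)
  have hSmono : ∀ r s, r ≤ s → S r ⊆ S s := fun r s hrs =>
    insert_subset_insert fun d ⟨x, hx, h⟩ => ⟨x, hx.trans hrs, h⟩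
  have hnonneg : ∀ r, 0 ≤ sSup (S r) := fun r => le_csSup (hSbdd r) (hS0 r)
  refine ⟨1, one_pos, fun r => 2 * sSup (S r), fun r _ => by linarith [hnonneg r],
    fun r s _ hrs => ?_, ?_, ?_, fun x _ y hy => ?_⟩
  · exact mul_le_mul_of_nonneg_left (csSup_le_csSup (hSbdd s) ⟨0, hS0 r⟩ (hSmono r s hrs)) two_pos.le
  · have h : sSup (S 0) ≤ 0 := by
      refine csSup_le ⟨0, hS0 0⟩ ?_
      rintro d (rfl | ⟨x, hx, y, hy, rfl⟩)
      · exact le_rfl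
      · obtain rfl : x = x₀ := sub_eq_zero.1 (norm_le_zero_iff.1 hx)
        exact (infDist_zero_of_mem hy.1).le
    simp [h.antisymm (hnonneg 0)]
  · rw [Metric.tendsto_nhds]
    intro ε hε
    obtain ⟨δ, hδ, h⟩ := exists_pos_forall_infDist_le hA hK (show 0 < ε / 4 by linarith)
    filter_upwards [nhdsWithin_le_nhds (Iio_mem_nhds hδ)] with r hr
    have hle : sSup (S r) ≤ ε / 4 := by
      refine csSup_le ⟨0, hS0 r⟩ ?_
      rintro d (rfl | ⟨x, hx, y, hy, rfl⟩)
      · linarith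
      · exact h x (hx.trans_lt hr) y hy
    rw [Real.dist_0_eq_abs, abs_of_nonneg (by linarith [hnonneg r])]
    linarith
  · have hle : infDist y (A x₀) ≤ sSup (S ‖x - x₀‖) :=
      le_csSup (hSbdd _) (mem_insert_of_mem _ ⟨x, le_rfl, y, hy, rfl⟩)
    rcases (infDist_nonneg (x := y) (s := A x₀)).eq_or_lt with h0 | h0
    · refine ⟨y, (hcl.mem_iff_infDist_zero hne).2 h0.symm, ?_⟩
      simpa using hnonneg ‖x - x₀‖
    · obtain ⟨w, hw, hlt⟩ := (infDist_lt_iff hne).1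
        (show infDist y (A x₀) < 2 * infDist y (A x₀) by linarith)
      refine ⟨w, hw, ?_⟩
      rw [← dist_eq_norm]
      linarith

end

/-- For `A : X ⇒ Y` between Banach spaces with `A 0 ≠ ∅`:
`A` is compactly R-continuous at `0` and `A 0` is closed if and only if
the graph of `A` is (sequentially) closed at the domain point `0`. -/
theorem compactRContinuousAt_and_closed_iff_graph_closed
    {X Y : Type*} [NormedAddCommGroup X] [NormedSpace ℝ X] [CompleteSpace X]
    [NormedAddCommGroup Y] [NormedSpace ℝ Y] [CompleteSpace Y]
    (A : X → Set Y) (hne : (A 0).Nonempty) :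
    (CompactRContinuousAt A 0 ∧ IsClosed (A 0)) ↔
      (∀ (x : ℕ → X) (y : ℕ → Y) (z : Y),
        Tendsto x atTop (nhds 0) → (∀ k, y k ∈ A (x k)) →
        Tendsto y atTop (nhds z) → z ∈ A 0) := by
  refine ⟨fun h x y z hx hxy hy => h.1.mem_of_tendsto h.2 hx hxy hy, fun h => ?_⟩
  have hcl : IsClosed (A 0) := IsSeqClosed.isClosed fun y z hy hz =>
    h (fun _ => 0) y z tendsto_const_nhds hy hz
  exact ⟨compactRContinuousAt_of_graph_closed hne h hcl, hcl⟩
end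

section
/- Let X and Y be real Banach spaces and let A : X ⇒ Y be a set-valued mapping with A(0) ≠ ∅. If A is locally compact around 0 (i.e., there exist σ₀ > 0 and a compact set C ⊆ Y such that A(x) ⊆ C for all ‖x‖ ≤ σ₀) and the graph of A is closed at the domain point 0, then A is R-continuous at 0. -/
open Filter Set

/-- If the values of `A` near `0` lie in a compact set and the graph of `A` is closed at `0`,
then the excess of `A x` over `A 0` is uniformly small for `x` near `0`. -/
theorem exists_forall_infDist_le_of_graph_closed {X Y : Type*} [NormedAddCommGroup X]
    [NormedAddCommGroup Y] {A : X → Set Y} {σ : ℝ} (hσ : 0 < σ) {C : Set Y} (hC : IsCompact C)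
    (hAC : ∀ x : X, ‖x‖ ≤ σ → A x ⊆ C)
    (hgraph : ∀ (x : ℕ → X) (y : ℕ → Y) (z : Y),
      Tendsto x atTop (nhds 0) → (∀ k, y k ∈ A (x k)) →
      Tendsto y atTop (nhds z) → z ∈ A 0) {ε : ℝ} (hε : 0 < ε) :
    ∃ δ > (0 : ℝ), ∀ x : X, ‖x‖ ≤ δ → ∀ y ∈ A x, Metric.infDist y (A 0) ≤ ε := by
  by_contra! h
  have hpos : ∀ n : ℕ, (0 : ℝ) < min σ (1 / ((n : ℝ) + 1)) := fun n => lt_min hσ (by positivity)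
  choose x hx y hy hlt using fun n : ℕ => h _ (hpos n)
  have hx0 : Tendsto x atTop (nhds 0) :=
    squeeze_zero_norm (fun n => (hx n).trans (min_le_right _ _))
      tendsto_one_div_add_atTop_nhds_zero_nat
  obtain ⟨z, -, φ, hφ, hz⟩ :=
    hC.tendsto_subseq fun n => hAC (x n) ((hx n).trans (min_le_left _ _)) (hy n)
  have hzA : z ∈ A 0 :=
    hgraph (x ∘ φ) (y ∘ φ) z (hx0.comp hφ.tendsto_atTop) (fun k => hy (φ k)) hz
  have hlim := ((Metric.continuous_infDist_pt (A 0)).tendsto z).comp hz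
  have hle : ε ≤ Metric.infDist z (A 0) := ge_of_tendsto' hlim fun k => (hlt (φ k)).le
  rw [Metric.infDist_zero_of_mem hzA] at hle
  exact hε.not_ge hle

/-- If `A : X ⇒ Y` between Banach spaces (with `A 0 ≠ ∅`) is locally
compact around `0` and its graph is closed at the domain point `0`, then `A` is
R-continuous at `0`. -/
theorem rContinuousAt_of_locallyCompact_of_graph_closed
    {X Y : Type*} [NormedAddCommGroup X] [NormedSpace ℝ X] [CompleteSpace X]
    [NormedAddCommGroup Y] [NormedSpace ℝ Y] [CompleteSpace Y]
    (A : X → Set Y) (hne : (A 0).Nonempty)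
    (hloc : ∃ σ₀ > (0 : ℝ), ∃ C : Set Y, IsCompact C ∧
      ∀ x : X, ‖x‖ ≤ σ₀ → A x ⊆ C)
    (hgraph : ∀ (x : ℕ → X) (y : ℕ → Y) (z : Y),
      Tendsto x atTop (nhds 0) → (∀ k, y k ∈ A (x k)) →
      Tendsto y atTop (nhds z) → z ∈ A 0) :
    RContinuousAt A 0 := by
  obtain ⟨σ, hσ, C, hC, hAC⟩ := hloc
  have hA0C : A 0 ⊆ C := hAC 0 (by simpa using hσ.le)
  have hA0 : IsCompact (A 0) := by
    refine hC.of_isClosed_subset (IsSeqClosed.isClosed fun y z hy hz => ?_) hA0C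
    exact hgraph (fun _ => 0) y z tendsto_const_nhds hy hz
  let S : ℝ → Set ℝ := fun r =>
    {d | ∃ x : X, ‖x‖ ≤ min r σ ∧ ∃ y ∈ A x, Metric.infDist y (A 0) = d}
  have hbdd : ∀ r, BddAbove (S r) := fun r => by
    refine (hC.bddAbove_image (Metric.continuous_infDist_pt (A 0)).continuousOn).mono ?_
    rintro _ ⟨x, hx, y, hy, rfl⟩
    exact mem_image_of_mem _ (hAC x (hx.trans (min_le_right _ _)) hy)
  have hS : ∀ r, 0 ≤ r → (S r).Nonempty := fun r hr => by
    obtain ⟨y, hy⟩ := hne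
    exact ⟨_, 0, by simpa using ⟨hr, hσ.le⟩, y, hy, rfl⟩
  have hnonneg : ∀ r, 0 ≤ sSup (S r) := fun r => Real.sSup_nonneg <| by
    rintro _ ⟨x, -, y, -, rfl⟩
    exact Metric.infDist_nonneg
  refine ⟨σ, hσ, fun r => sSup (S r), fun r _ => hnonneg r, fun r s hr hrs => ?_, ?_, ?_, ?_⟩
  · refine csSup_le_csSup (hbdd s) (hS r hr) ?_
    rintro d ⟨x, hx, hd⟩
    exact ⟨x, hx.trans (min_le_min_right σ hrs), hd⟩
  · refine le_antisymm (csSup_le (hS 0 le_rfl) ?_) (hnonneg 0)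
    rintro _ ⟨x, hx, y, hy, rfl⟩
    obtain rfl : x = 0 := norm_le_zero_iff.1 (hx.trans (min_le_left _ _))
    exact (Metric.infDist_zero_of_mem hy).le
  · rw [Metric.tendsto_nhdsWithin_nhds]
    intro ε hε
    obtain ⟨δ, hδ, h⟩ :=
      exists_forall_infDist_le_of_graph_closed hσ hC hAC hgraph (half_pos hε)
    refine ⟨δ, hδ, fun {r} hr hrδ => ?_⟩
    have hr0 : 0 < r := hr
    rw [Real.dist_0_eq_abs, abs_of_pos hr0] at hrδ
    rw [Real.dist_0_eq_abs, abs_of_nonneg (hnonneg r)]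
    refine (csSup_le (hS r hr0.le) ?_).trans_lt (half_lt_self hε)
    rintro _ ⟨x, hx, y, hy, rfl⟩
    exact h x ((hx.trans (min_le_left _ _)).trans hrδ.le) y hy
  · intro x hx y hy
    rw [sub_zero] at hx ⊢
    obtain ⟨ybar, hybar, hd⟩ := hA0.exists_infDist_eq_dist hne y
    refine ⟨ybar, hybar, ?_⟩
    rw [← dist_eq_norm, ← hd]
    exact le_csSup (hbdd _) ⟨x, le_min le_rfl hx, y, hy, rfl⟩
end

section
/- Let f : ℝⁿ → ℝᵐ with m ≥ n be continuously differentiable, let S := f⁻¹(0) be nonempty, and suppose the Jacobian (the derivative of f, as a linear map ℝⁿ → ℝᵐ) is injective (full rank) at every point of S. Then the inverse mapping f⁻¹ : y ↦ {x ∈ ℝⁿ | f(x) = y} is compactly R-Lipschitz continuous at 0; that is, for every compact set K ⊆ ℝⁿ there exist σ > 0 and L > 0 such that f⁻¹(y) ∩ K ⊆ S + L‖y‖·B for all y ∈ ℝᵐ with ‖y‖ ≤ σ, where B is the closed unit ball of ℝⁿ. -/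
open Filter Set

/-- Near a zero at which the derivative is injective, the distance to the zero is bounded by a
multiple of `‖f x‖`. -/
theorem exists_eventually_norm_sub_le_of_injective_fderiv
    {E F : Type*} [NormedAddCommGroup E] [NormedSpace ℝ E] [FiniteDimensional ℝ E]
    [NormedAddCommGroup F] [NormedSpace ℝ F] {f : E → F} {f' : E →L[ℝ] F} {x : E}
    (hf : HasFDerivAt f f' x) (hx : f x = 0) (hinj : Function.Injective f') :
    ∃ L > (0 : ℝ), ∀ᶠ z in nhds x, ‖z - x‖ ≤ L * ‖f z‖ := by
  have hind : Topology.IsInducing f' :=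
    (LinearMap.isClosedEmbedding_of_injective (f := (f' : E →ₗ[ℝ] F))
      (LinearMap.ker_eq_bot.2 hinj)).isInducing
  obtain ⟨L, hL, h⟩ := (hf.isTheta_sub hind).isBigO_symm.exists_pos
  refine ⟨L, hL, ?_⟩
  filter_upwards [h.bound] with z hz
  simpa [hx] using hz

/-- Near a point where a continuous `f` does not vanish, the distance to any fixed point `s` is
bounded by a multiple of `‖f x‖`. -/
theorem exists_eventually_norm_sub_le_of_ne_zero
    {E F : Type*} [NormedAddCommGroup E] [NormedAddCommGroup F] {f : E → F} {x : E}
    (hf : ContinuousAt f x) (hx : f x ≠ 0) (s : E) :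
    ∃ L > (0 : ℝ), ∀ᶠ z in nhds x, ‖z - s‖ ≤ L * ‖f z‖ := by
  have hpos : 0 < ‖f x‖ := norm_pos_iff.2 hx
  refine ⟨(‖x - s‖ + 1) / (‖f x‖ / 2), by positivity, ?_⟩
  have hnear : ∀ᶠ z in nhds x, ‖z - s‖ < ‖x - s‖ + 1 :=
    (continuous_id.sub continuous_const).norm.continuousAt.eventually_lt_const (lt_add_one _)
  have hfar : ∀ᶠ z in nhds x, ‖f x‖ / 2 < ‖f z‖ :=
    hf.norm.eventually_const_lt (half_lt_self hpos)
  filter_upwards [hnear, hfar] with z hz hfz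
  calc ‖z - s‖ ≤ ‖x - s‖ + 1 := hz.le
    _ = (‖x - s‖ + 1) / (‖f x‖ / 2) * (‖f x‖ / 2) := by field_simp
    _ ≤ (‖x - s‖ + 1) / (‖f x‖ / 2) * ‖f z‖ := by gcongr

/-- Let `f : ℝⁿ → ℝᵐ` (`m ≥ n`) be `C¹` with nonempty zero set
`S = f⁻¹(0)` and derivative injective (full rank) at every point of `S`. Then the inverse
mapping `y ↦ {x | f x = y}` is compactly R-Lipschitz continuous at `0`: for every compact
`K ⊆ ℝⁿ` there are `σ > 0` and `L > 0` with `f⁻¹(y) ∩ K ⊆ S + L‖y‖·𝔹` whenever `‖y‖ ≤ σ`. -/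
theorem compactRLipschitz_of_inverse
    {n m : ℕ} (hmn : n ≤ m)
    (f : EuclideanSpace ℝ (Fin n) → EuclideanSpace ℝ (Fin m))
    (hf : ContDiff ℝ 1 f)
    (hS : {x : EuclideanSpace ℝ (Fin n) | f x = 0}.Nonempty)
    (hrank : ∀ x : EuclideanSpace ℝ (Fin n), f x = 0 →
      Function.Injective (fderiv ℝ f x)) :
    ∀ K : Set (EuclideanSpace ℝ (Fin n)), IsCompact K →
      ∃ σ > (0 : ℝ), ∃ L > (0 : ℝ),
        ∀ y : EuclideanSpace ℝ (Fin m), ‖y‖ ≤ σ →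
          ∀ x ∈ K, f x = y →
            ∃ s : EuclideanSpace ℝ (Fin n), f s = 0 ∧ ‖x - s‖ ≤ L * ‖y‖ := by
  intro K hK
  obtain ⟨L, hL, h⟩ : ∃ L > (0 : ℝ), ∀ x ∈ K, ∃ s, f s = 0 ∧ ‖x - s‖ ≤ L * ‖f x‖ := by
    refine hK.induction_on (p := fun T => ∃ L > (0 : ℝ), ∀ x ∈ T, ∃ s, f s = 0 ∧
      ‖x - s‖ ≤ L * ‖f x‖) ⟨1, one_pos, by simp⟩ ?_ ?_ ?_
    · rintro T U hTU ⟨L, hL, h⟩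
      exact ⟨L, hL, fun x hx => h x (hTU hx)⟩
    · rintro T U ⟨L, hL, hT⟩ ⟨M, hM, hU⟩
      refine ⟨max L M, lt_max_of_lt_left hL, ?_⟩
      rintro x (hx | hx)
      · obtain ⟨s, hs, hxs⟩ := hT x hx
        exact ⟨s, hs, hxs.trans (by gcongr; exact le_max_left _ _)⟩
      · obtain ⟨s, hs, hxs⟩ := hU x hx
        exact ⟨s, hs, hxs.trans (by gcongr; exact le_max_right _ _)⟩
    · intro x _
      obtain ⟨s, hs, L, hL, h⟩ : ∃ s, f s = 0 ∧ ∃ L > (0 : ℝ),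
          ∀ᶠ z in nhds x, ‖z - s‖ ≤ L * ‖f z‖ := by
        by_cases hx : f x = 0
        · exact ⟨x, hx, exists_eventually_norm_sub_le_of_injective_fderiv
            ((hf.differentiable one_ne_zero) x).hasFDerivAt hx (hrank x hx)⟩
        · obtain ⟨s, hs⟩ := hS
          exact ⟨s, hs, exists_eventually_norm_sub_le_of_ne_zero hf.continuous.continuousAt hx s⟩
      exact ⟨_, mem_nhdsWithin_of_mem_nhds h, L, hL, fun z hz => ⟨s, hs, hz⟩⟩
  refine ⟨1, one_pos, L, hL, ?_⟩
  rintro _ - x hx rfl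
  exact h x hx
end

section
/- Let U ⊆ ℝⁿ be open and let f : U → ℝ be real-analytic on U with S := {x ∈ U | f(x) = 0} nonempty. Then the solution mapping y ↦ {x ∈ U | f(x) = y} is compactly R-Hölder continuous at 0: for every compact set K ⊆ U there exist σ > 0, L > 0, and θ > 0 such that for all y ∈ ℝ with |y| ≤ σ, {x ∈ K | f(x) = y} ⊆ S + L|y|^θ·B, where B is the closed unit ball of ℝⁿ. -/
open Filter Set

section

open scoped Topology

/-! ### Extension of scalars for power series -/

/-- The power series in elements of a Banach algebra `A` obtained from a real power series in the
coordinates indexed by `ι`. -/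
noncomputable def scalarExt {ι : Type*} [Fintype ι] (A : Type*) [NormedRing A] [NormedAlgebra ℝ A]
    (p : FormalMultilinearSeries ℝ (ι → ℝ) ℝ) : FormalMultilinearSeries ℝ (ι → A) A := by
  classical
  exact fun n => ∑ i : Fin n → ι, p n (fun j => Pi.single (i j) (1 : ℝ)) •
    (ContinuousMultilinearMap.mkPiAlgebraFin ℝ n A).compContinuousLinearMap
      (fun j => ContinuousLinearMap.proj (i j))

theorem scalarExt_apply {ι : Type*} [Fintype ι] [DecidableEq ι] {A : Type*} [NormedRing A]
    [NormedAlgebra ℝ A] (p : FormalMultilinearSeries ℝ (ι → ℝ) ℝ) (n : ℕ) (a : Fin n → ι → A) :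
    scalarExt A p n a = ∑ i : Fin n → ι, p n (fun j => Pi.single (i j) (1 : ℝ)) •
      (List.ofFn fun j => a j (i j)).prod := by
  simp only [scalarExt, sum_apply, smul_apply,
    ContinuousMultilinearMap.compContinuousLinearMap_apply,
    ContinuousMultilinearMap.mkPiAlgebraFin_apply, ContinuousLinearMap.proj_apply]
  refine Finset.sum_congr rfl fun i _ => ?_
  congr!

theorem norm_scalarExt_le {ι : Type*} [Fintype ι] {A : Type*} [NormedRing A]
    [NormedAlgebra ℝ A] [NormOneClass A] (p : FormalMultilinearSeries ℝ (ι → ℝ) ℝ) (n : ℕ) :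
    ‖scalarExt A p n‖ ≤ ‖p n‖ * (Fintype.card ι : ℝ) ^ n := by
  classical
  refine ContinuousMultilinearMap.opNorm_le_bound (by positivity) fun a => ?_
  rw [scalarExt_apply]
  have key : ∀ i ∈ (Finset.univ : Finset (Fin n → ι)),
      ‖p n (fun j => Pi.single (i j) (1 : ℝ)) • (List.ofFn fun j => a j (i j)).prod‖ ≤
        ‖p n‖ * ∏ j, ‖a j‖ := by
    intro i _
    rw [norm_smul]
    have h1 : ‖p n (fun j => Pi.single (i j) (1 : ℝ))‖ ≤ ‖p n‖ := by
      have h := (p n).le_opNorm (fun j => Pi.single (i j) (1 : ℝ))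
      have h' : ∏ j, ‖(Pi.single (i j) (1 : ℝ) : ι → ℝ)‖ = 1 :=
        Finset.prod_eq_one fun j _ => (Pi.norm_single _).trans norm_one
      rwa [h', mul_one] at h
    have h2 : ‖(List.ofFn fun j => a j (i j)).prod‖ ≤ ∏ j, ‖a j‖ := by
      refine (List.norm_prod_le _).trans ?_
      rw [List.map_ofFn, List.prod_ofFn]
      exact Finset.prod_le_prod (fun _ _ => norm_nonneg _) fun j _ => norm_le_pi_norm (a j) (i j)
    exact mul_le_mul h1 h2 (norm_nonneg _) (norm_nonneg _)
  refine (norm_sum_le _ _).trans ((Finset.sum_le_card_nsmul _ _ _ key).trans_eq ?_)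
  simp
  ring

theorem scalarExt_radius_pos {ι : Type*} [Fintype ι] {A : Type*} [NormedRing A]
    [NormedAlgebra ℝ A] [NormOneClass A] {p : FormalMultilinearSeries ℝ (ι → ℝ) ℝ}
    (hp : 0 < p.radius) : 0 < (scalarExt A p).radius := by
  obtain ⟨C, r, hC, hr, h⟩ := p.le_mul_pow_of_radius_pos hp
  set ρ : NNReal := ⟨(r * (Fintype.card ι + 1))⁻¹, by positivity⟩ with hρ
  have hρ0 : 0 < ρ := by
    rw [← NNReal.coe_pos]
    change 0 < (r * (Fintype.card ι + 1))⁻¹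
    positivity
  refine lt_of_lt_of_le (ENNReal.coe_pos.2 hρ0)
    ((scalarExt A p).le_radius_of_bound C fun n => ?_)
  have h1 : ‖scalarExt A p n‖ ≤ C * r ^ n * (Fintype.card ι + 1 : ℝ) ^ n :=
    (norm_scalarExt_le p n).trans (mul_le_mul (h n)
      (pow_le_pow_left₀ (by positivity) (by linarith) n) (by positivity) (by positivity))
  have h2 : (ρ : ℝ) = (r * (Fintype.card ι + 1))⁻¹ := rfl
  calc _ ≤ C * r ^ n * (Fintype.card ι + 1 : ℝ) ^ n * (ρ : ℝ) ^ n := by gcongr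
    _ = C * ((r * (Fintype.card ι + 1)) * (ρ : ℝ)) ^ n := by rw [mul_pow, mul_pow]; ring
    _ ≤ C := by rw [h2, mul_inv_cancel₀ (by positivity), one_pow, mul_one]

theorem list_prod_ofFn_intertwine {A H : Type*} [NormedRing A] [NormedAlgebra ℝ A]
    [NormedAddCommGroup H] [NormedSpace ℝ H] (ρ : A →L[ℝ] (H →L[ℝ] H))
    (hmul : ∀ a b, ρ (a * b) = ρ a * ρ b) (hone : ρ 1 = 1) (φ : H →L[ℝ] ℝ) :
    ∀ (n : ℕ) (g : Fin n → A) (c : Fin n → ℝ), (∀ j w, φ (ρ (g j) w) = c j * φ w) →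
      ∀ w, φ (ρ (List.ofFn g).prod w) = (∏ j, c j) * φ w := by
  intro n
  induction n with
  | zero => intro g c _ w; simp [hone]
  | succ n ih =>
    intro g c h w
    rw [List.ofFn_succ, List.prod_cons, hmul, mul_apply_eq_comp, h,
      ih _ (fun j => c j.succ) (fun j w => h _ _), Fin.prod_univ_succ, mul_assoc]

theorem scalarExt_intertwine {ι A H : Type*} [Fintype ι] [NormedRing A] [NormedAlgebra ℝ A]
    [NormedAddCommGroup H] [NormedSpace ℝ H] (ρ : A →L[ℝ] (H →L[ℝ] H))
    (hmul : ∀ a b, ρ (a * b) = ρ a * ρ b) (hone : ρ 1 = 1)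
    (p : FormalMultilinearSeries ℝ (ι → ℝ) ℝ) (φ : H →L[ℝ] ℝ)
    (a : ι → A) (c : ι → ℝ) (h : ∀ i w, φ (ρ (a i) w) = c i * φ w) (n : ℕ) (w : H) :
    φ (ρ (scalarExt A p n (fun _ => a)) w) = p n (fun _ => c) * φ w := by
  classical
  have hc : c = ∑ i, c i • Pi.single (M := fun _ => ℝ) i (1 : ℝ) := by
    ext k
    simp [Finset.sum_apply, Pi.single_apply]
  have h1 : p n (fun _ => c) = ∑ i : Fin n → ι, (∏ j, c (i j)) *
      p n (fun j => Pi.single (i j) (1 : ℝ)) := by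
    conv_lhs => rw [hc]
    rw [ContinuousMultilinearMap.map_sum (p n)
      (fun _ i => c i • Pi.single (M := fun _ => ℝ) i (1 : ℝ))]
    refine Finset.sum_congr rfl fun i _ => ?_
    rw [ContinuousMultilinearMap.map_smul_univ, smul_eq_mul]
  rw [scalarExt_apply, h1, map_sum, sum_apply, map_sum, Finset.sum_mul]
  refine Finset.sum_congr rfl fun i _ => ?_
  rw [map_smul, smul_apply, map_smul, smul_eq_mul,
    list_prod_ofFn_intertwine ρ hmul hone φ n _ (fun j => c (i j)) (fun j w => h _ _)]
  ring

/-- On a single coordinate axis the extension of scalars is a power series in one variable. -/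
theorem scalarExt_single {ι : Type*} [Fintype ι] [DecidableEq ι] {A : Type*} [NormedRing A]
    [NormedAlgebra ℝ A] (p : FormalMultilinearSeries ℝ (ι → ℝ) ℝ) (i₀ : ι) (b : A) (n : ℕ) :
    scalarExt A p n (fun _ => Pi.single i₀ b) =
      p n (fun _ => Pi.single i₀ (1 : ℝ)) • b ^ n := by
  rw [scalarExt_apply, Finset.sum_eq_single (fun _ => i₀)]
  · simp
  · intro i _ hi
    obtain ⟨j, hj⟩ : ∃ j, i j ≠ i₀ := by
      by_contra! hcon
      exact hi (funext hcon)
    have : (List.ofFn fun j => (Pi.single i₀ b : ι → A) (i j)).prod = 0 := by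
      rcases subsingleton_or_nontrivial A with hA | hA
      · exact Subsingleton.elim _ _
      · refine List.prod_eq_zero ?_
        rw [List.mem_ofFn]
        exact ⟨j, by simp [hj]⟩
    rw [this, smul_zero]
  · simp

/-! ### Shift operators on bounded sequences -/

/-- The space of bounded real sequences. -/
abbrev BddSeq : Type := BoundedContinuousFunction ℕ ℝ

/-- The right shift of bounded sequences. -/
noncomputable def rightShift : BddSeq →L[ℝ] BddSeq :=
  LinearMap.mkContinuous
    { toFun := fun w => BoundedContinuousFunction.ofNormedAddCommGroupDiscrete
        (fun n => Nat.casesOn n 0 fun k => w k) ‖w‖ (by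
          rintro (_ | n)
          · simp
          · exact w.norm_coe_le_norm n)
      map_add' := fun v w => by
        ext n; cases n <;> simp
      map_smul' := fun c w => by
        ext n; cases n <;> simp }
    1 (fun w => by
      rw [one_mul, BoundedContinuousFunction.norm_le (norm_nonneg _)]
      rintro (_ | n)
      · simp
      · exact w.norm_coe_le_norm n)

/-- The left shift of bounded sequences. -/
noncomputable def leftShift : BddSeq →L[ℝ] BddSeq :=
  LinearMap.mkContinuous
    { toFun := fun w => BoundedContinuousFunction.ofNormedAddCommGroupDiscrete
        (fun n => w (n + 1)) ‖w‖ (fun n => w.norm_coe_le_norm _)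
      map_add' := fun v w => by ext n; simp
      map_smul' := fun c w => by ext n; simp }
    1 (fun w => by
      rw [one_mul, BoundedContinuousFunction.norm_le (norm_nonneg _)]
      exact fun n => w.norm_coe_le_norm _)

theorem rightShift_apply_zero (w : BddSeq) : rightShift w 0 = 0 := rfl

theorem rightShift_apply_succ (w : BddSeq) (n : ℕ) : rightShift w (n + 1) = w n := rfl

theorem leftShift_apply (w : BddSeq) (n : ℕ) : leftShift w n = w (n + 1) := rfl

theorem leftShift_pow_apply (d : ℕ) (w : BddSeq) (n : ℕ) : (leftShift ^ d) w n = w (n + d) := by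
  induction d generalizing n with
  | zero => rfl
  | succ d ih =>
    rw [pow_succ', mul_apply_eq_comp, leftShift_apply, ih]
    congr 1
    ring

theorem rightShift_pow_apply_of_lt {d n : ℕ} (h : n < d) (w : BddSeq) :
    (rightShift ^ d) w n = 0 := by
  induction d generalizing n with
  | zero => omega
  | succ d ih =>
    rw [pow_succ', mul_apply_eq_comp]
    cases n with
    | zero => rfl
    | succ n => rw [rightShift_apply_succ, ih (by omega)]

theorem rightShift_pow_apply_add (d n : ℕ) (w : BddSeq) : (rightShift ^ d) w (n + d) = w n := by
  induction d with
  | zero => rfl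
  | succ d ih =>
    rw [pow_succ', mul_apply_eq_comp, ← add_assoc, rightShift_apply_succ, ih]

theorem leftShift_pow_rightShift_pow (d : ℕ) (w : BddSeq) :
    (leftShift ^ d) ((rightShift ^ d) w) = w := by
  ext n
  rw [leftShift_pow_apply, rightShift_pow_apply_add]

theorem summable_bddSeq_mul_pow (w : BddSeq) {s : ℝ} (hs : |s| ≤ 1 / 2) :
    Summable fun n => w n * s ^ n := by
  refine Summable.of_norm_bounded (g := fun n => ‖w‖ * (1 / 2 : ℝ) ^ n)
    (summable_geometric_two.mul_left _) fun n => ?_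
  rw [norm_mul, norm_pow]
  have := w.norm_coe_le_norm n
  have h2 : ‖s‖ ≤ 1 / 2 := hs
  gcongr

/-- The value at `s` of the power series with a given bounded sequence of coefficients. -/
noncomputable def seriesEval (s : ℝ) (hs : |s| ≤ 1 / 2) : BddSeq →L[ℝ] ℝ :=
  LinearMap.mkContinuous
    { toFun := fun w => ∑' n, w n * s ^ n
      map_add' := fun v w => by
        rw [← (summable_bddSeq_mul_pow v hs).tsum_add (summable_bddSeq_mul_pow w hs)]
        simp [add_mul]
      map_smul' := fun c w => by
        simp only [BoundedContinuousFunction.coe_smul, smul_eq_mul, RingHom.id_apply, mul_assoc]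
        rw [tsum_mul_left] }
    2 (fun w => by
      have h : HasSum (fun n => ‖w‖ * (1 / 2 : ℝ) ^ n) (‖w‖ * 2) := hasSum_geometric_two.mul_left _
      rw [mul_comm]
      refine tsum_of_norm_bounded h fun n => ?_
      rw [norm_mul, norm_pow]
      have := w.norm_coe_le_norm n
      have h2 : ‖s‖ ≤ 1 / 2 := hs
      gcongr)

theorem seriesEval_apply (s : ℝ) (hs : |s| ≤ 1 / 2) (w : BddSeq) :
    seriesEval s hs w = ∑' n, w n * s ^ n := rfl

theorem abs_seriesEval_le (s : ℝ) (hs : |s| ≤ 1 / 2) (w : BddSeq) :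
    |seriesEval s hs w| ≤ 2 * ‖w‖ := by
  refine (seriesEval s hs).le_of_opNorm_le ?_ w
  exact LinearMap.mkContinuous_norm_le _ (by norm_num) _

theorem seriesEval_eq_sum_add (s : ℝ) (hs : |s| ≤ 1 / 2) (d : ℕ) (w : BddSeq) :
    seriesEval s hs w =
      ∑ k ∈ Finset.range d, w k * s ^ k + s ^ d * seriesEval s hs ((leftShift ^ d) w) := by
  rw [seriesEval_apply, seriesEval_apply, ← (summable_bddSeq_mul_pow w hs).sum_add_tsum_nat_add d,
    ← tsum_mul_left]
  congr 1
  refine tsum_congr fun n => ?_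
  rw [leftShift_pow_apply, pow_add]
  ring

theorem seriesEval_rightShift (s : ℝ) (hs : |s| ≤ 1 / 2) (w : BddSeq) :
    seriesEval s hs (rightShift w) = s * seriesEval s hs w := by
  have h := seriesEval_eq_sum_add s hs 1 (rightShift w)
  have h2 := leftShift_pow_rightShift_pow 1 w
  simp only [pow_one] at h2
  simpa [rightShift_apply_zero, h2] using h

/-- The sequence `1, 0, 0, …`. -/
noncomputable def unitSeq : BddSeq :=
  BoundedContinuousFunction.ofNormedAddCommGroupDiscrete (fun n => if n = 0 then 1 else 0) 1
    (fun n => by split_ifs <;> simp)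

theorem seriesEval_unitSeq (s : ℝ) (hs : |s| ≤ 1 / 2) : seriesEval s hs unitSeq = 1 := by
  rw [seriesEval_apply, tsum_eq_single 0]
  · simp [unitSeq]
  · intro n hn
    simp [unitSeq, hn]

instance : Nontrivial BddSeq :=
  ⟨⟨unitSeq, 0, fun h => by
    have := congrArg (fun w : BddSeq => w 0) h
    simp [unitSeq] at this⟩⟩

/-! ### The Weierstrass preparation theorem -/

theorem seriesEval_rightShift_pow (s : ℝ) (hs : |s| ≤ 1 / 2) (d : ℕ) (w : BddSeq) :
    seriesEval s hs ((rightShift ^ d) w) = s ^ d * seriesEval s hs w := by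
  induction d with
  | zero => simp
  | succ d ih =>
    rw [pow_succ', mul_apply_eq_comp, seriesEval_rightShift, ih, pow_succ']
    ring

theorem tendsto_scalarExt_axis {ι : Type*} [Fintype ι] [DecidableEq ι]
    {A : Type*} [NormedRing A] [NormedAlgebra ℝ A] [NormOneClass A] [CompleteSpace A]
    {p : FormalMultilinearSeries ℝ (ι → ℝ) ℝ} (hp : 0 < p.radius) (i₀ : ι) {d : ℕ}
    (hlow : ∀ k < d, p k (fun _ => Pi.single i₀ 1) = 0)
    (hd : p d (fun _ => Pi.single i₀ 1) ≠ 0) (S : A) :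
    Tendsto (fun t : ℝ => (p d (fun _ => Pi.single i₀ 1) * t ^ d)⁻¹ •
      (scalarExt A p).sum (Pi.single i₀ (t • S))) (𝓝[≠] 0) (𝓝 (S ^ d)) := by
  set c := p d (fun _ => Pi.single i₀ 1) with hc
  set q := scalarExt A p with hq
  have hF : HasFPowerSeriesAt q.sum q 0 :=
    (q.hasFPowerSeriesOnBall (scalarExt_radius_pos hp)).hasFPowerSeriesAt
  have hO := hF.isBigO_sub_partialSum_pow (d + 1)
  have hcont : Continuous fun t : ℝ => (Pi.single i₀ (t • S) : ι → A) :=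
    (continuous_single i₀).comp (continuous_id.smul continuous_const)
  have htend : Tendsto (fun t : ℝ => (Pi.single i₀ (t • S) : ι → A)) (𝓝 0) (𝓝 0) := by
    simpa using hcont.tendsto 0
  obtain ⟨C, hC⟩ := (hO.comp_tendsto htend).bound
  have hpart : ∀ t : ℝ, q.partialSum (d + 1) (Pi.single i₀ (t • S)) = (c * t ^ d) • S ^ d := by
    intro t
    rw [FormalMultilinearSeries.partialSum, Finset.sum_range_succ, Finset.sum_eq_zero, zero_add,
      hq, scalarExt_single, smul_pow, smul_smul]
    intro k hk
    rw [hq, scalarExt_single, hlow k (Finset.mem_range.1 hk), zero_smul]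
  rw [tendsto_iff_norm_sub_tendsto_zero]
  have hlim : Tendsto (fun t : ℝ => |c|⁻¹ * (C * ‖S‖ ^ (d + 1)) * |t|) (𝓝[≠] 0) (𝓝 0) := by
    have : Continuous fun t : ℝ => |c|⁻¹ * (C * ‖S‖ ^ (d + 1)) * |t| := by fun_prop
    simpa using (this.tendsto 0).mono_left nhdsWithin_le_nhds
  refine squeeze_zero' (Eventually.of_forall fun _ => norm_nonneg _) ?_ hlim
  filter_upwards [hC.filter_mono nhdsWithin_le_nhds, self_mem_nhdsWithin] with t ht ht0
  have ht0 : t ≠ 0 := ht0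
  have hct : c * t ^ d ≠ 0 := mul_ne_zero hd (pow_ne_zero _ ht0)
  simp only [Function.comp, zero_add, hpart, norm_pow, norm_norm, Pi.norm_single] at ht
  have h1 : (c * t ^ d)⁻¹ • q.sum (Pi.single i₀ (t • S)) - S ^ d =
      (c * t ^ d)⁻¹ • (q.sum (Pi.single i₀ (t • S)) - (c * t ^ d) • S ^ d) := by
    rw [smul_sub, smul_smul, inv_mul_cancel₀ hct, one_smul]
  rw [h1, norm_smul, norm_inv, norm_mul, norm_pow, Real.norm_eq_abs, Real.norm_eq_abs]
  have hta : 0 < |t| := abs_pos.2 ht0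
  have hca : 0 < |c| := abs_pos.2 hd
  calc (|c| * |t| ^ d)⁻¹ * ‖q.sum (Pi.single i₀ (t • S)) - (c * t ^ d) • S ^ d‖
      ≤ (|c| * |t| ^ d)⁻¹ * (C * ‖t • S‖ ^ (d + 1)) := by gcongr
    _ = |c|⁻¹ * (C * ‖S‖ ^ (d + 1)) * |t| := by
      rw [norm_smul, Real.norm_eq_abs]
      field_simp
      ring

theorem weierstrass_preparation_of_representation {A : Type*} [NormedRing A] [NormedAlgebra ℝ A]
    [NormOneClass A] [CompleteSpace A] (ρ : A →L[ℝ] (BddSeq →L[ℝ] BddSeq))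
    (hmul : ∀ a b, ρ (a * b) = ρ a * ρ b) (hone : ρ 1 = 1) (S σ : A) (hS : ρ S = rightShift)
    (hσ : ρ σ = leftShift) {m : ℕ} {f : (Fin (m + 1) → ℝ) → ℝ}
    {p : FormalMultilinearSeries ℝ (Fin (m + 1) → ℝ) ℝ} (hf : HasFPowerSeriesAt f p 0) {d : ℕ}
    (hlow : ∀ k < d, p k (fun _ => Pi.single 0 1) = 0)
    (hd : p d (fun _ => Pi.single 0 1) ≠ 0) :
    ∃ r > (0 : ℝ), ∃ κ : ℝ, κ ≠ 0 ∧ ∃ b : (Fin m → ℝ) → (Fin d → ℝ), AnalyticAt ℝ b 0 ∧ b 0 = 0 ∧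
      ∀ᶠ x in 𝓝 0, ∀ s : ℝ, |s| ≤ 1 / 2 → ∃ v : ℝ, 1 / 2 ≤ |v| ∧ |v| ≤ 2 ∧
        s ^ d + ∑ i, b x i * s ^ (i : ℕ) = v * κ * f (Fin.cons (r * s) x) := by
  have hp : 0 < p.radius := hf.radius_pos
  set c := p d (fun _ => Pi.single 0 1) with hc
  set q := scalarExt A p with hqdef
  have hqr : 0 < q.radius := scalarExt_radius_pos hp
  have hF := q.hasFPowerSeriesOnBall hqr
  set F := q.sum with hFdef
  have hpow : ∀ (a : A) (n : ℕ), ρ (a ^ n) = ρ a ^ n := by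
    intro a n
    induction n with
    | zero => simp [hone]
    | succ n ih => rw [pow_succ, pow_succ, hmul, ih]
  let T : ℝ → A := fun t =>
    (c * t ^ d)⁻¹ • F (Pi.single 0 (t • S)) * σ ^ d + (1 - S ^ d * σ ^ d)
  have hT : Tendsto T (𝓝[≠] 0) (𝓝 1) := by
    have h := ((tendsto_scalarExt_axis hp 0 hlow hd S).mul_const (σ ^ d)).add_const
      (1 - S ^ d * σ ^ d)
    rwa [add_sub_cancel] at h
  have hTunit : ∀ᶠ t in 𝓝[≠] (0 : ℝ), IsUnit (T t) :=
    hT (Units.isOpen.mem_nhds isUnit_one)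
  have hW : Tendsto (fun t => (leftShift ^ d) (ρ (Ring.inverse (T t)) ((rightShift ^ d) unitSeq)))
      (𝓝[≠] 0) (𝓝 unitSeq) := by
    have h1 : Tendsto (fun t => Ring.inverse (T t)) (𝓝[≠] 0) (𝓝 1) := by
      have := (NormedRing.inverse_continuousAt (1 : Aˣ)).tendsto
      simp only [Units.val_one, Ring.inverse_one] at this
      exact this.comp hT
    have h2 : Tendsto (fun t => ρ (Ring.inverse (T t)) ((rightShift ^ d) unitSeq)) (𝓝[≠] 0)
        (𝓝 (ρ 1 ((rightShift ^ d) unitSeq))) :=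
      ((ContinuousLinearMap.apply ℝ BddSeq ((rightShift ^ d) unitSeq)).continuous.tendsto _).comp
        ((ρ.continuous.tendsto _).comp h1)
    have h3 := ((leftShift ^ d).continuous.tendsto _).comp h2
    rw [hone, one_apply_eq_self, leftShift_pow_rightShift_pow] at h3
    exact h3
  have hball : ∀ᶠ t in 𝓝[≠] (0 : ℝ), (Pi.single 0 (t • S) : Fin (m + 1) → _) ∈
      Metric.eball (0 : Fin (m + 1) → A) q.radius := by
    have hcont : Continuous fun t : ℝ => (Pi.single 0 (t • S) : Fin (m + 1) → _) :=
      (continuous_single 0).comp (continuous_id.smul continuous_const)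
    refine (hcont.tendsto 0).mono_left nhdsWithin_le_nhds (Metric.isOpen_eball.mem_nhds ?_)
    simpa using hqr
  obtain ⟨δ, hδ, hsum⟩ := Metric.eventually_nhds_iff.1 hf.eventually_hasSum
  have hsmall : ∀ᶠ t in 𝓝[>] (0 : ℝ), t < δ :=
    nhdsWithin_le_nhds (Iio_mem_nhds hδ)
  have hle : 𝓝[>] (0 : ℝ) ≤ 𝓝[≠] 0 := nhdsWithin_mono _ fun t ht => ne_of_gt ht
  obtain ⟨r, hr0, hrδ, hrunit, hrW, hrball⟩ : ∃ r ∈ Ioi (0 : ℝ), r < δ ∧ IsUnit (T r) ∧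
      (leftShift ^ d) (ρ (Ring.inverse (T r)) ((rightShift ^ d) unitSeq)) ∈
        Metric.ball unitSeq (1 / 8) ∧
      (Pi.single 0 (r • S) : Fin (m + 1) → A) ∈ Metric.eball 0 q.radius := by
    have hW' := hW.eventually (Metric.ball_mem_nhds unitSeq (by norm_num : (0 : ℝ) < 1 / 8))
    have hall : ∀ᶠ r in 𝓝[>] (0 : ℝ), r ∈ Ioi (0 : ℝ) ∧ r < δ ∧ IsUnit (T r) ∧
        (leftShift ^ d) (ρ (Ring.inverse (T r)) ((rightShift ^ d) unitSeq)) ∈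
          Metric.ball unitSeq (1 / 8) ∧
        (Pi.single 0 (r • S) : Fin (m + 1) → A) ∈ Metric.eball 0 q.radius := by
      filter_upwards [self_mem_nhdsWithin, hsmall, hTunit.filter_mono hle, hW'.filter_mono hle,
        hball.filter_mono hle] with t h1 h2 h3 h4 h5
      exact ⟨h1, h2, h3, h4, h5⟩
    exact hall.exists
  have hr0 : 0 < r := hr0
  set κ := (c * r ^ d)⁻¹ with hκ
  let a : (Fin m → ℝ) → (Fin (m + 1) → A) := fun x =>
    Fin.cons (r • S) fun i => x i • 1
  have ha0 : a 0 = Pi.single 0 (r • S) := by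
    ext i
    refine Fin.cases ?_ (fun i => ?_) i <;> simp [a]
  have ha : AnalyticAt ℝ a 0 := by
    refine AnalyticAt.pi fun i => ?_
    refine Fin.cases ?_ (fun i => ?_) i
    · simpa [a] using analyticAt_const
    · simp only [Fin.cons_succ]
      exact ((ContinuousLinearMap.proj (R := ℝ) (φ := fun _ : Fin m => ℝ) i).analyticAt _).smul
        analyticAt_const
  let G : (Fin m → ℝ) → A := fun x => F (a x)
  have hG : AnalyticAt ℝ G 0 := by
    refine AnalyticAt.comp (g := F) ?_ ha
    rw [ha0]
    exact hF.analyticAt_of_mem (by simpa using hrball)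
  let L : (Fin m → ℝ) → A := fun x =>
    κ • G x * σ ^ d + (1 - S ^ d * σ ^ d)
  have hL0 : L 0 = T r := by simp only [L, G, T, ha0, hκ]
  have hL : AnalyticAt ℝ L 0 :=
    (((analyticAt_const (v := κ)).smul hG).mul analyticAt_const).add analyticAt_const
  let w : (Fin m → ℝ) → BddSeq := fun x => ρ (Ring.inverse (L x)) ((rightShift ^ d) unitSeq)
  have hw : AnalyticAt ℝ w 0 := by
    have h1 : AnalyticAt ℝ (fun x => Ring.inverse (L x)) 0 := by
      obtain ⟨u, hu⟩ := hrunit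
      refine AnalyticAt.comp (g := Ring.inverse) ?_ hL
      rw [hL0, ← hu]
      exact analyticAt_inverse u
    exact (((ContinuousLinearMap.apply ℝ BddSeq ((rightShift ^ d) unitSeq)).comp ρ).analyticAt
      _).comp h1
  have hLw : ∀ x, IsUnit (L x) → ρ (L x) (w x) = (rightShift ^ d) unitSeq := by
    intro x hx
    simp only [w]
    rw [← mul_apply_eq_comp, ← hmul, Ring.mul_inverse_cancel _ hx, hone, one_apply_eq_self]
  have hLapply : ∀ x u, ρ (L x) u =
      κ • ρ (G x) ((leftShift ^ d) u) + (u - (rightShift ^ d) ((leftShift ^ d) u)) := by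
    intro x u
    simp only [L, map_add, map_sub, hmul, map_smul, hone, hpow, hS, hσ]
    rfl
  refine ⟨r, hr0, κ, inv_ne_zero (mul_ne_zero hd (pow_ne_zero _ hr0.ne')),
    fun x i => -(w x i), ?_, ?_, ?_⟩
  · refine AnalyticAt.pi fun i => ?_
    exact (((BoundedContinuousFunction.evalCLM ℝ (i : ℕ)).analyticAt _).comp hw).neg
  · ext i
    have h0 := congrArg (fun u : BddSeq => u i) ((hLapply 0 (w 0)).symm.trans
      (hLw 0 (by rwa [hL0])))
    have hG0 : ∀ u, ρ (G 0) u i = 0 := by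
      intro u
      have h1 := hF.hasSum (y := a 0) (by rw [ha0]; exact hrball)
      have h2 := h1.mapL ((BoundedContinuousFunction.evalCLM ℝ (i : ℕ)).comp
        ((ContinuousLinearMap.apply ℝ BddSeq u).comp ρ))
      have h3 : ∀ n, ((BoundedContinuousFunction.evalCLM ℝ (i : ℕ)).comp
          ((ContinuousLinearMap.apply ℝ BddSeq u).comp ρ)) (q n fun _ => a 0) = 0 := by
        intro n
        rw [ha0, hqdef, scalarExt_single]
        rcases lt_or_ge n d with hn | hn
        · rw [hlow n hn, zero_smul, map_zero]
        · have := rightShift_pow_apply_of_lt (lt_of_lt_of_le i.2 hn) u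
          simp only [ContinuousLinearMap.comp_apply, map_smul, hpow, hS, smul_pow,
            ContinuousLinearMap.apply_apply, BoundedContinuousFunction.evalCLM_apply, this, smul_zero]
      simp only [h3, zero_add] at h2
      exact h2.unique hasSum_zero
    simp only [BoundedContinuousFunction.coe_add, BoundedContinuousFunction.coe_smul,
      BoundedContinuousFunction.coe_sub, Pi.add_apply, Pi.sub_apply, hG0,
      rightShift_pow_apply_of_lt i.2, smul_zero, zero_add, sub_zero] at h0
    simp [h0]
  · have e1 : ∀ᶠ x in 𝓝 0, IsUnit (L x) :=
      hL.continuousAt (Units.isOpen.mem_nhds (by rw [hL0]; exact hrunit))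
    have e2 : ∀ᶠ x in 𝓝 0, ‖(leftShift ^ d) (w x) - unitSeq‖ < 1 / 8 := by
      have hcont : ContinuousAt (fun x => (leftShift ^ d) (w x)) 0 :=
        (leftShift ^ d).continuous.continuousAt.comp hw.continuousAt
      have : (leftShift ^ d) (w 0) ∈ Metric.ball unitSeq (1 / 8) := by
        simp only [w, hL0]
        exact hrW
      filter_upwards [hcont (Metric.isOpen_ball.mem_nhds this)] with x hx
      rw [← dist_eq_norm]
      exact hx
    have e3 : ∀ᶠ x in 𝓝 0, a x ∈ Metric.eball 0 q.radius :=
      ha.continuousAt (Metric.isOpen_eball.mem_nhds (by rw [ha0]; exact hrball))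
    filter_upwards [e1, e2, e3, Metric.ball_mem_nhds (0 : Fin m → ℝ) hδ] with x h1 h2 h3 h4 s hs
    set v := seriesEval s hs ((leftShift ^ d) (w x)) with hv
    have hv1 : |v - 1| ≤ 1 / 4 := by
      have h5 := abs_seriesEval_le s hs ((leftShift ^ d) (w x) - unitSeq)
      rw [map_sub, seriesEval_unitSeq, ← hv] at h5
      linarith
    have hGf : ∀ u, seriesEval s hs (ρ (G x) u) = f (Fin.cons (r * s) x) * seriesEval s hs u := by
      intro u
      have h5 := (hF.hasSum h3).mapL
        ((seriesEval s hs).comp ((ContinuousLinearMap.apply ℝ BddSeq u).comp ρ))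
      have h6 : dist (Fin.cons (r * s) x : Fin (m + 1) → ℝ) 0 < δ := by
        rw [dist_pi_lt_iff hδ]
        refine Fin.cases ?_ fun i => ?_
        · rw [Fin.cons_zero, Pi.zero_apply, Real.dist_eq, sub_zero, abs_mul, abs_of_pos hr0]
          nlinarith [abs_nonneg s]
        · rw [Fin.cons_succ]
          exact (dist_le_pi_dist x 0 i).trans_lt h4
      have h7 := (hsum h6).mul_right (seriesEval s hs u)
      have h8 : ∀ n, ((seriesEval s hs).comp ((ContinuousLinearMap.apply ℝ BddSeq u).comp ρ))
          (q n fun _ => a x) = p n (fun _ => Fin.cons (r * s) x) * seriesEval s hs u := by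
        intro n
        refine scalarExt_intertwine ρ hmul hone p (seriesEval s hs) (a x) _ (fun i u => ?_) n u
        refine Fin.cases ?_ (fun i => ?_) i
        · simp only [a, Fin.cons_zero, map_smul, hS, smul_apply, seriesEval_rightShift, smul_eq_mul,
            mul_assoc]
        · simp only [a, Fin.cons_succ, map_smul, hone, smul_apply, smul_eq_mul, one_apply_eq_self]
      simp only [h8, zero_add] at h5 h7
      exact h5.unique h7
    have h5 := congrArg (seriesEval s hs) ((hLapply x (w x)).symm.trans (hLw x h1))
    rw [map_add, map_sub, map_smul, hGf, smul_eq_mul, seriesEval_rightShift_pow,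
      seriesEval_rightShift_pow, seriesEval_unitSeq, seriesEval_eq_sum_add s hs d (w x), ← hv,
      Finset.sum_range] at h5
    have h9 := abs_le.1 hv1
    refine ⟨v, ?_, ?_, ?_⟩
    · rw [abs_of_pos (by linarith)]
      linarith
    · rw [abs_of_pos (by linarith)]
      linarith
    · simp only [neg_mul, Finset.sum_neg_distrib]
      linear_combination -h5

theorem weierstrass_preparation {m : ℕ} {f : (Fin (m + 1) → ℝ) → ℝ}
    {p : FormalMultilinearSeries ℝ (Fin (m + 1) → ℝ) ℝ} (hf : HasFPowerSeriesAt f p 0) {d : ℕ}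
    (hlow : ∀ k < d, p k (fun _ => Pi.single 0 1) = 0)
    (hd : p d (fun _ => Pi.single 0 1) ≠ 0) :
    ∃ r > (0 : ℝ), ∃ κ : ℝ, κ ≠ 0 ∧ ∃ b : (Fin m → ℝ) → (Fin d → ℝ), AnalyticAt ℝ b 0 ∧ b 0 = 0 ∧
      ∀ᶠ x in 𝓝 0, ∀ s : ℝ, |s| ≤ 1 / 2 → ∃ v : ℝ, 1 / 2 ≤ |v| ∧ |v| ≤ 2 ∧
        s ^ d + ∑ i, b x i * s ^ (i : ℕ) = v * κ * f (Fin.cons (r * s) x) :=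
  weierstrass_preparation_of_representation (A := BddSeq →L[ℝ] BddSeq)
    (ContinuousLinearMap.id ℝ _) (fun _ _ => rfl) rfl rightShift leftShift rfl rfl hf hlow hd

/-! ### Monic polynomials with small real coefficients -/

open Polynomial in
/-- The monic polynomial of degree `d` with lower coefficients `b`, over the complex numbers. -/
noncomputable def monicPoly {d : ℕ} (b : Fin d → ℝ) : ℂ[X] :=
  X ^ d + ∑ i, C (b i : ℂ) * X ^ (i : ℕ)

theorem monicPoly_monic {d : ℕ} (b : Fin d → ℝ) : (monicPoly b).Monic :=
  Polynomial.monic_X_pow_add (Polynomial.degree_sum_fin_lt _)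

theorem natDegree_monicPoly {d : ℕ} (b : Fin d → ℝ) : (monicPoly b).natDegree = d := by
  apply Polynomial.natDegree_eq_of_degree_eq_some
  rw [monicPoly, Polynomial.degree_add_eq_left_of_degree_lt, Polynomial.degree_X_pow]
  rw [Polynomial.degree_X_pow]
  exact Polynomial.degree_sum_fin_lt _

theorem eval_monicPoly {d : ℕ} (b : Fin d → ℝ) (z : ℂ) :
    (monicPoly b).eval z = z ^ d + ∑ i, (b i : ℂ) * z ^ (i : ℕ) := by
  simp [monicPoly, Polynomial.eval_finsetSum]

theorem coeff_monicPoly {d : ℕ} (b : Fin d → ℝ) (i : Fin d) :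
    (monicPoly b).coeff i = b i := by
  simp only [monicPoly, Polynomial.coeff_add, Polynomial.coeff_X_pow, Polynomial.finsetSum_coeff,
    Polynomial.coeff_C_mul]
  rw [if_neg i.2.ne, Finset.sum_eq_single i]
  · simp
  · intro j _ hj
    rw [if_neg (fun h => hj (Fin.ext h.symm)), mul_zero]
  · simp

theorem exists_roots_monicPoly {d : ℕ} (b : Fin d → ℝ) :
    ∃ α : Fin d → ℂ, (monicPoly b).roots = Finset.univ.val.map α := by
  have hc : Multiset.card (monicPoly b).roots = d := by
    rw [← (IsAlgClosed.splits (monicPoly b)).natDegree_eq_card_roots, natDegree_monicPoly]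
  obtain ⟨l, hl⟩ := Quot.exists_rep (monicPoly b).roots
  have hl' : l.length = d := by rw [← hc, ← hl]; rfl
  subst hl'
  refine ⟨fun i => l.get i, ?_⟩
  rw [← hl]
  simp [Fin.univ_def]

theorem eval_monicPoly_eq_prod {d : ℕ} {b : Fin d → ℝ} {α : Fin d → ℂ}
    (h : (monicPoly b).roots = Finset.univ.val.map α) (z : ℂ) :
    (monicPoly b).eval z = ∏ i, (z - α i) := by
  rw [(IsAlgClosed.splits (monicPoly b)).eval_eq_prod_roots_of_monic (monicPoly_monic b), h,
    Multiset.map_map]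
  rfl

theorem exists_root_near {d : ℕ} (hd : 0 < d) (b : Fin d → ℝ) (z : ℂ) :
    ∃ β : ℂ, (monicPoly b).eval β = 0 ∧ ‖z - β‖ ^ d ≤ ‖(monicPoly b).eval z‖ := by
  obtain ⟨α, hα⟩ := exists_roots_monicPoly b
  have : Nonempty (Fin d) := ⟨⟨0, hd⟩⟩
  obtain ⟨i, -, hi⟩ := Finset.exists_min_image Finset.univ (fun i => ‖z - α i‖)
    Finset.univ_nonempty
  refine ⟨α i, ?_, ?_⟩
  · rw [eval_monicPoly_eq_prod hα]
    exact Finset.prod_eq_zero (Finset.mem_univ i) (sub_self _)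
  · rw [eval_monicPoly_eq_prod hα, norm_prod]
    calc ‖z - α i‖ ^ d = ∏ _j : Fin d, ‖z - α i‖ := by simp
      _ ≤ ∏ j, ‖z - α j‖ := Finset.prod_le_prod (fun _ _ => norm_nonneg _) fun j hj => hi j hj

theorem eval_conj_monicPoly {d : ℕ} (b : Fin d → ℝ) (z : ℂ) :
    (monicPoly b).eval (starRingEnd ℂ z) = starRingEnd ℂ ((monicPoly b).eval z) := by
  simp [eval_monicPoly]

theorem norm_root_le_one {d : ℕ} {b : Fin d → ℝ} (hb : ∑ i, |b i| ≤ 1) {z : ℂ}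
    (hz : (monicPoly b).eval z = 0) : ‖z‖ ≤ 1 := by
  by_contra! h
  rw [eval_monicPoly] at hz
  rcases Nat.eq_zero_or_pos d with rfl | hd
  · simp at hz
  have h1 : ‖z ^ d‖ ≤ ‖z‖ ^ (d - 1) := by
    rw [eq_neg_of_add_eq_zero_left hz, norm_neg]
    calc ‖∑ i, (b i : ℂ) * z ^ (i : ℕ)‖ ≤ ∑ i, |b i| * ‖z‖ ^ (d - 1) := by
          refine (norm_sum_le _ _).trans (Finset.sum_le_sum fun i _ => ?_)
          rw [norm_mul, norm_pow, Complex.norm_real, Real.norm_eq_abs]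
          gcongr
          · exact h.le
          · have := i.2
            omega
      _ = (∑ i, |b i|) * ‖z‖ ^ (d - 1) := by rw [Finset.sum_mul]
      _ ≤ ‖z‖ ^ (d - 1) := mul_le_of_le_one_left (by positivity) hb
  rw [norm_pow] at h1
  exact absurd h1 (not_le.2 (pow_lt_pow_right₀ h (by omega)))

/-! ### Subdiscriminants -/

/-- The sum over all `k`-tuples of indices of the discriminants of the chosen variables. -/
noncomputable def discSum (k d : ℕ) : MvPolynomial (Fin d) ℝ :=
  ∑ φ : Fin k → Fin d, ∏ p ∈ Finset.univ.offDiag,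
    (MvPolynomial.X (φ p.1) - MvPolynomial.X (φ p.2))

theorem discSum_isSymmetric (k d : ℕ) : (discSum k d).IsSymmetric := by
  intro e
  simp only [discSum, map_sum, map_prod, map_sub, MvPolynomial.rename_X]
  exact Fintype.sum_equiv (Equiv.arrowCongr (Equiv.refl _) e) _ _ fun φ => by simp

theorem aeval_discSum (k d : ℕ) (α : Fin d → ℂ) :
    MvPolynomial.aeval α (discSum k d) = ∑ φ : Fin k → Fin d, ∏ p ∈ Finset.univ.offDiag,
      (α (φ p.1) - α (φ p.2)) := by
  simp [discSum]

theorem exists_analytic_of_isSymmetric {d : ℕ} {D : MvPolynomial (Fin d) ℝ}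
    (hD : D.IsSymmetric) :
    ∃ g : (Fin d → ℝ) → ℝ, (∀ b, AnalyticAt ℝ g b) ∧ ∀ b (α : Fin d → ℂ),
      (monicPoly b).roots = Finset.univ.val.map α → MvPolynomial.aeval α D = (g b : ℂ) := by
  obtain ⟨q, hq⟩ := (MvPolynomial.esymmAlgEquiv (Fin d) ℝ (Fintype.card_fin d)).surjective ⟨D, hD⟩
  have hq' : D = MvPolynomial.aeval (fun i : Fin d => MvPolynomial.esymm (Fin d) ℝ (i + 1)) q := by
    rw [← MvPolynomial.esymmAlgHom_apply]
    exact (congrArg Subtype.val hq).symm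
  refine ⟨fun b => MvPolynomial.aeval (fun i : Fin d => (-1 : ℝ) ^ ((i : ℕ) + 1) * b i.rev) q,
    fun b => AnalyticAt.aeval_mvPolynomial (fun i => ?_) q, fun b α h => ?_⟩
  · exact analyticAt_const.mul ((ContinuousLinearMap.proj (R := ℝ) (φ := fun _ : Fin d => ℝ)
      i.rev).analyticAt b)
  · have hc : Multiset.card (monicPoly b).roots = d := by simp [h]
    have he : ∀ i : Fin d, MvPolynomial.aeval α (MvPolynomial.esymm (Fin d) ℝ (i + 1)) =
        (((-1 : ℝ) ^ ((i : ℕ) + 1) * b i.rev : ℝ) : ℂ) := by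
      intro i
      rw [MvPolynomial.aeval_esymm_eq_multiset_esymm, ← h]
      have hv := Polynomial.coeff_eq_esymm_roots_of_splits (IsAlgClosed.splits (monicPoly b))
        (k := (i.rev : ℕ)) (by rw [natDegree_monicPoly]; exact i.rev.2.le)
      rw [(monicPoly_monic b).leadingCoeff, one_mul, natDegree_monicPoly, coeff_monicPoly] at hv
      have hi : d - (i.rev : ℕ) = i + 1 := by
        rw [Fin.val_rev]
        have := i.2
        omega
      rw [hi] at hv
      push_cast
      rw [hv, ← mul_assoc, ← mul_pow]
      simp
    rw [hq', MvPolynomial.comp_aeval_apply]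
    simp only [he]
    exact (MvPolynomial.comp_aeval_apply _ Complex.ofRealAm q).symm

theorem prod_offDiag_comp {k d : ℕ} {α : Fin d → ℂ} (hk : (Finset.univ.image α).card = k)
    {φ : Fin k → Fin d} (hφ : Function.Injective (α ∘ φ)) :
    ∏ p ∈ (Finset.univ : Finset (Fin k)).offDiag, (α (φ p.1) - α (φ p.2)) =
      ∏ p ∈ (Finset.univ.image α).offDiag, (p.1 - p.2) := by
  have himg : Finset.univ.image (α ∘ φ) = Finset.univ.image α := by
    apply Finset.eq_of_subset_of_card_le
    · intro z hz
      simp only [Finset.mem_image, Finset.mem_univ, true_and, Function.comp] at hz ⊢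
      obtain ⟨i, hi⟩ := hz
      exact ⟨_, hi⟩
    · rw [hk, Finset.card_image_of_injective _ hφ]
      simp
  refine Finset.prod_nbij (fun p => (α (φ p.1), α (φ p.2))) ?_ ?_ ?_ (fun _ _ => rfl)
  · intro p hp
    simp only [Finset.mem_offDiag, Finset.mem_univ, true_and] at hp ⊢
    exact ⟨Finset.mem_image_of_mem _ (Finset.mem_univ _),
      Finset.mem_image_of_mem _ (Finset.mem_univ _), fun h => hp (hφ h)⟩
  · rintro ⟨a, b⟩ _ ⟨c, e⟩ _ h
    simp only [Prod.mk.injEq] at h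
    exact Prod.ext (hφ h.1) (hφ h.2)
  · rintro ⟨z, w⟩ h
    rw [← himg] at h
    simp only [Finset.coe_offDiag, Set.mem_offDiag, Finset.mem_coe, Finset.mem_image,
      Finset.mem_univ, true_and, Function.comp] at h
    obtain ⟨⟨i, rfl⟩, ⟨j, rfl⟩, hij⟩ := h
    exact ⟨(i, j), by simpa using fun h => hij (by rw [h]), rfl⟩

theorem discSum_prod_eq_zero {k d : ℕ} {α : Fin d → ℂ} {φ : Fin k → Fin d}
    (hφ : ¬ Function.Injective (α ∘ φ)) :
    ∏ p ∈ (Finset.univ : Finset (Fin k)).offDiag, (α (φ p.1) - α (φ p.2)) = 0 := by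
  simp only [Function.Injective, not_forall] at hφ
  obtain ⟨i, j, h, hij⟩ := hφ
  exact Finset.prod_eq_zero (i := (i, j)) (by simpa using hij) (sub_eq_zero.2 h)

theorem aeval_discSum_eq_zero {k d : ℕ} {α : Fin d → ℂ} (hk : (Finset.univ.image α).card < k) :
    MvPolynomial.aeval α (discSum k d) = 0 := by
  rw [aeval_discSum]
  refine Finset.sum_eq_zero fun φ _ => discSum_prod_eq_zero fun h => ?_
  have h1 : (Finset.univ.image (α ∘ φ)).card = k := by
    rw [Finset.card_image_of_injective _ h]
    simp
  have h2 : Finset.univ.image (α ∘ φ) ⊆ Finset.univ.image α := by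
    intro z hz
    simp only [Finset.mem_image, Finset.mem_univ, true_and, Function.comp] at hz ⊢
    obtain ⟨i, hi⟩ := hz
    exact ⟨_, hi⟩
  have := Finset.card_le_card h2
  omega

theorem exists_aeval_discSum {k d : ℕ} {α : Fin d → ℂ} (hk : (Finset.univ.image α).card = k) :
    ∃ N : ℕ, N ≠ 0 ∧ N ≤ d ^ k ∧ MvPolynomial.aeval α (discSum k d) =
      N * ∏ p ∈ (Finset.univ.image α).offDiag, (p.1 - p.2) := by
  classical
  refine ⟨(Finset.univ.filter fun φ : Fin k → Fin d => Function.Injective (α ∘ φ)).card,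
    ?_, ?_, ?_⟩
  · rw [Finset.card_ne_zero]
    have hmem : ∀ z : Finset.univ.image α, ∃ i, α i = z := fun z => by
      obtain ⟨i, -, hi⟩ := Finset.mem_image.1 z.2
      exact ⟨i, hi⟩
    choose ψ hψ using hmem
    let e := (Finset.univ.image α).equivFinOfCardEq hk
    refine ⟨fun i => ψ (e.symm i), ?_⟩
    simp only [Finset.mem_filter, Finset.mem_univ, true_and]
    intro i j hij
    simp only [Function.comp, hψ] at hij
    exact e.symm.injective (Subtype.ext hij)
  · refine (Finset.card_filter_le _ _).trans ?_
    simp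
  · rw [aeval_discSum, ← nsmul_eq_mul, ← Finset.sum_const, Finset.sum_filter]
    refine Finset.sum_congr rfl fun φ _ => ?_
    split_ifs with h
    · exact prod_offDiag_comp hk h
    · exact discSum_prod_eq_zero h

theorem norm_prod_offDiag_le {R : Finset ℂ} (hR : ∀ z ∈ R, ‖z‖ ≤ 1) {z : ℂ} (hz : z ∈ R)
    (hz' : starRingEnd ℂ z ∈ R) (him : z.im ≠ 0) :
    ‖∏ p ∈ R.offDiag, (p.1 - p.2)‖ ≤ 2 ^ (R.card * R.card) * (2 * |z.im|) := by
  have hmem : (z, starRingEnd ℂ z) ∈ R.offDiag := by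
    simp only [Finset.mem_offDiag]
    exact ⟨hz, hz', fun h => him (Complex.conj_eq_iff_im.1 h.symm)⟩
  rw [norm_prod, ← Finset.prod_erase_mul _ _ hmem]
  have h1 : ‖z - starRingEnd ℂ z‖ = 2 * |z.im| := by
    rw [Complex.sub_conj]
    simp
  rw [h1]
  gcongr
  calc ∏ p ∈ R.offDiag.erase (z, starRingEnd ℂ z), ‖p.1 - p.2‖
      ≤ ∏ p ∈ R.offDiag.erase (z, starRingEnd ℂ z), (2 : ℝ) := by
        refine Finset.prod_le_prod (fun _ _ => norm_nonneg _) fun p hp => ?_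
        have hp := Finset.mem_offDiag.1 (Finset.mem_of_mem_erase hp)
        linarith [norm_sub_le p.1 p.2, hR _ hp.1, hR _ hp.2.1]
    _ = 2 ^ (R.offDiag.erase (z, starRingEnd ℂ z)).card := by simp
    _ ≤ 2 ^ (R.card * R.card) := by
        refine pow_le_pow_right₀ one_le_two ((Finset.card_erase_le).trans ?_)
        rw [Finset.offDiag_card]
        omega

theorem exists_root_count_function (d r : ℕ) :
    ∃ F : (Fin d → ℝ) → ℝ, ∃ C > (0 : ℝ), (∀ b, AnalyticAt ℝ F b) ∧ ∀ b,
      (F b = 0 ↔ (monicPoly b).roots.toFinset.card ≤ r) ∧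
      ((monicPoly b).roots.toFinset.card = r + 1 → (∑ i, |b i| ≤ 1) → ∀ z : ℂ,
        (monicPoly b).eval z = 0 → z.im ≠ 0 → |F b| ≤ C * |z.im|) := by
  choose g hg hgα using fun k => exists_analytic_of_isSymmetric (discSum_isSymmetric k d)
  have key : ∀ b : Fin d → ℝ, ∃ α : Fin d → ℂ, (monicPoly b).roots = Finset.univ.val.map α ∧
      (monicPoly b).roots.toFinset = Finset.univ.image α := by
    intro b
    obtain ⟨α, hα⟩ := exists_roots_monicPoly b
    refine ⟨α, hα, ?_⟩
    rw [hα]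
    rfl
  have hzero : ∀ b k, (monicPoly b).roots.toFinset.card < k → g k b = 0 := by
    intro b k hk
    obtain ⟨α, h1, h2⟩ := key b
    rw [h2] at hk
    have := hgα k b α h1
    rw [aeval_discSum_eq_zero hk] at this
    exact_mod_cast this.symm
  refine ⟨fun b => ∑ k ∈ Finset.Ioc r d, g k b ^ 2,
    ((d : ℝ) ^ (r + 1) * (2 ^ ((r + 1) * (r + 1)) * 2) + 1) ^ 2, by positivity, fun b => ?_,
    fun b => ⟨⟨fun h => ?_, fun h => ?_⟩, fun hc hb z hz him => ?_⟩⟩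
  · exact Finset.analyticAt_fun_sum _ fun k _ => (hg k b).pow 2
  · by_contra! hr
    set k := (monicPoly b).roots.toFinset.card with hk
    have hkd : k ≤ d := by
      have h1 := Multiset.toFinset_card_le (monicPoly b).roots
      have h2 := Polynomial.card_roots' (monicPoly b)
      rw [natDegree_monicPoly] at h2
      omega
    have h0 := (Finset.sum_eq_zero_iff_of_nonneg (fun k _ => sq_nonneg (g k b))).1 h k
      (Finset.mem_Ioc.2 ⟨hr, hkd⟩)
    obtain ⟨α, h1, h2⟩ := key b
    rw [h2] at hk
    obtain ⟨N, hN, -, hN'⟩ := exists_aeval_discSum hk.symm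
    rw [hgα k b α h1, pow_eq_zero_iff two_ne_zero |>.1 h0] at hN'
    have : (N : ℂ) * ∏ p ∈ (Finset.univ.image α).offDiag, (p.1 - p.2) ≠ 0 := by
      refine mul_ne_zero (Nat.cast_ne_zero.2 hN) (Finset.prod_ne_zero_iff.2 fun p hp => ?_)
      exact sub_ne_zero.2 (Finset.mem_offDiag.1 hp).2.2
    exact this (by simpa using hN'.symm)
  · refine Finset.sum_eq_zero fun k hk => ?_
    rw [hzero b k (h.trans_lt (Finset.mem_Ioc.1 hk).1)]
    simp
  · obtain ⟨α, h1, h2⟩ := key b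
    have hroots : ∀ w, w ∈ (monicPoly b).roots.toFinset ↔ (monicPoly b).eval w = 0 := by
      intro w
      rw [Multiset.mem_toFinset, Polynomial.mem_roots (monicPoly_monic b).ne_zero]
      rfl
    have hz1 : |z.im| ≤ 1 := (Complex.abs_im_le_norm z).trans (norm_root_le_one hb hz)
    have hV := norm_prod_offDiag_le (R := (monicPoly b).roots.toFinset)
      (fun w hw => norm_root_le_one hb ((hroots w).1 hw)) ((hroots z).2 hz)
      ((hroots _).2 (by rw [eval_conj_monicPoly, hz, map_zero])) him
    rw [hc] at hV
    rw [h2] at hV hc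
    obtain ⟨N, hN, hNd, hN'⟩ := exists_aeval_discSum hc
    rw [hgα _ b α h1] at hN'
    have hgb : |g (r + 1) b| ≤ (d : ℝ) ^ (r + 1) * (2 ^ ((r + 1) * (r + 1)) * 2) * |z.im| := by
      rw [← Real.norm_eq_abs, ← Complex.norm_real, hN', norm_mul, Complex.norm_natCast, mul_assoc,
        mul_assoc]
      gcongr
      exact_mod_cast hNd
    have hsum : ∑ k ∈ Finset.Ioc r d, g k b ^ 2 ≤ g (r + 1) b ^ 2 := by
      by_cases hrd : r + 1 ∈ Finset.Ioc r d
      · rw [Finset.sum_eq_single_of_mem _ hrd]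
        intro k hk hkr
        rw [hzero b k]
        · simp
        · rw [h2, hc]
          have := (Finset.mem_Ioc.1 hk).1
          omega
      · rw [Finset.Ioc_eq_empty]
        · simpa using sq_nonneg _
        · simp at hrd ⊢
          omega
    rw [abs_of_nonneg (Finset.sum_nonneg fun k _ => sq_nonneg (g k b))]
    refine hsum.trans ?_
    set A := (d : ℝ) ^ (r + 1) * (2 ^ ((r + 1) * (r + 1)) * 2) with hA
    have hA0 : 0 ≤ A := by positivity
    calc g (r + 1) b ^ 2 = |g (r + 1) b| ^ 2 := (sq_abs _).symm
      _ ≤ (A * |z.im|) ^ 2 := by gcongr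
      _ = A ^ 2 * (|z.im| * |z.im|) := by ring
      _ ≤ (A + 1) ^ 2 * (|z.im| * 1) := by gcongr; linarith
      _ = (A + 1) ^ 2 * |z.im| := by ring

/-! ### Local Łojasiewicz inequalities -/

theorem le_mul_rpow_trans {A B e C D θ η : ℝ} (hB : 0 ≤ B) (he : 0 ≤ e) (hC : 0 ≤ C)
    (hD : 0 ≤ D) (hθ : 0 ≤ θ) (h₁ : A ≤ C * B ^ θ) (h₂ : B ≤ D * e ^ η) :
    A ≤ C * D ^ θ * e ^ (η * θ) := by
  refine h₁.trans ?_
  rw [Real.rpow_mul he, mul_assoc, ← Real.mul_rpow hD (Real.rpow_nonneg he _)]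
  gcongr

theorem le_mul_rpow_mono {A e C C' θ θ' : ℝ} (he : 0 ≤ e) (he' : e ≤ 1) (hC : 0 ≤ C)
    (hθ' : 0 ≤ θ') (hCC' : C ≤ C') (hθ : θ' ≤ θ) (h : A ≤ C * e ^ θ) : A ≤ C' * e ^ θ' := by
  refine h.trans ?_
  have := Real.rpow_le_rpow_of_exponent_ge' he he' hθ' hθ
  have := hC.trans hCC'
  gcongr

theorem le_rpow_one_div_of_pow_le {A B : ℝ} {d : ℕ} (hd : d ≠ 0) (hA : 0 ≤ A)
    (h : A ^ d ≤ B) : A ≤ 1 * B ^ (1 / (d : ℝ)) := by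
  rw [one_mul]
  calc A = (A ^ d) ^ (1 / (d : ℝ)) := by
        rw [one_div, Real.pow_rpow_inv_natCast hA hd]
    _ ≤ B ^ (1 / (d : ℝ)) := by gcongr

/-- Near `a`, the distance to the zero set of `f` is bounded by a power of `|f|`. -/
def LojasiewiczAt {E : Type*} [NormedAddCommGroup E] (f : E → ℝ) (a : E) : Prop :=
  ∃ C > (0 : ℝ), ∃ θ > (0 : ℝ), ∀ᶠ x in 𝓝 a, ∃ s, f s = 0 ∧ ‖x - s‖ ≤ C * |f x| ^ θ

/-- Near `0`, each root of a polynomial of the family `b` with at most `r` distinct roots is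
close to a real root of a nearby polynomial, as measured by its imaginary part. -/
def RealRootNear {m d : ℕ} (b : (Fin m → ℝ) → (Fin d → ℝ)) (r : ℕ) : Prop :=
  ∃ C > (0 : ℝ), ∃ θ > (0 : ℝ), ∀ᶠ x in 𝓝 0, ∀ z : ℂ, (monicPoly (b x)).eval z = 0 →
    (monicPoly (b x)).roots.toFinset.card ≤ r → ∃ (y : Fin m → ℝ) (t : ℝ),
      (monicPoly (b y)).eval (t : ℂ) = 0 ∧ ‖x - y‖ ≤ C * |z.im| ^ θ ∧ ‖z - t‖ ≤ C * |z.im| ^ θ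

theorem norm_eval_monicPoly_sub_le {d : ℕ} (b c : Fin d → ℝ) {z : ℂ} (hz : ‖z‖ ≤ 1) :
    ‖(monicPoly b).eval z - (monicPoly c).eval z‖ ≤ d * ‖b - c‖ := by
  rw [eval_monicPoly, eval_monicPoly, add_sub_add_left_eq_sub, ← Finset.sum_sub_distrib]
  calc ‖∑ i, ((b i : ℂ) * z ^ (i : ℕ) - (c i : ℂ) * z ^ (i : ℕ))‖
      ≤ ∑ _i : Fin d, ‖b - c‖ := by
        refine norm_sum_le_of_le _ fun i _ => ?_
        rw [← sub_mul, ← Complex.ofReal_sub, norm_mul, norm_pow, Complex.norm_real]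
        calc ‖b i - c i‖ * ‖z‖ ^ (i : ℕ) ≤ ‖b - c‖ * 1 :=
              mul_le_mul (norm_le_pi_norm (b - c) i) (pow_le_one₀ (norm_nonneg _) hz)
                (by positivity) (norm_nonneg _)
          _ = ‖b - c‖ := mul_one _
    _ = d * ‖b - c‖ := by simp

theorem exists_real_of_im_eq_zero {z : ℂ} (h : z.im = 0) : ((z.re : ℝ) : ℂ) = z :=
  Complex.ext (by simp) (by simp [h])

theorem two_le_card_roots_monicPoly {d : ℕ} {b : Fin d → ℝ} {z : ℂ}
    (hz : (monicPoly b).eval z = 0) (him : z.im ≠ 0) :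
    2 ≤ (monicPoly b).roots.toFinset.card := by
  have hroots : ∀ w, (monicPoly b).eval w = 0 → w ∈ (monicPoly b).roots.toFinset := by
    intro w hw
    rw [Multiset.mem_toFinset, Polynomial.mem_roots (monicPoly_monic b).ne_zero]
    exact hw
  refine Finset.one_lt_card.2 ⟨z, hroots z hz, starRingEnd ℂ z, hroots _ ?_, fun h => ?_⟩
  · rw [eval_conj_monicPoly, hz, map_zero]
  · exact him (Complex.conj_eq_iff_im.1 h.symm)

theorem card_roots_monicPoly_zero_le (d : ℕ) :
    (monicPoly (0 : Fin d → ℝ)).roots.toFinset.card ≤ 1 := by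
  refine Finset.card_le_one.2 fun z hz w hw => ?_
  have key : ∀ z ∈ (monicPoly (0 : Fin d → ℝ)).roots.toFinset, z = 0 := by
    intro z hz
    rw [Multiset.mem_toFinset, Polynomial.mem_roots (monicPoly_monic _).ne_zero,
      Polynomial.IsRoot.def, eval_monicPoly] at hz
    simp at hz
    exact hz.1
  rw [key z hz, key w hw]

theorem realRootNear_one {m d : ℕ} (b : (Fin m → ℝ) → (Fin d → ℝ)) : RealRootNear b 1 := by
  refine ⟨1, one_pos, 1, one_pos, Eventually.of_forall fun x z hz hc => ?_⟩
  have him : z.im = 0 := by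
    by_contra h
    have := two_le_card_roots_monicPoly hz h
    omega
  refine ⟨x, z.re, ?_, ?_, ?_⟩
  · rw [exists_real_of_im_eq_zero him, hz]
  · simp
  · simp [exists_real_of_im_eq_zero him]

theorem RealRootNear.succ {m d : ℕ} (hd : d ≠ 0) {b : (Fin m → ℝ) → (Fin d → ℝ)}
    (hb : AnalyticAt ℝ b 0) (hb0 : b 0 = 0)
    (hm : ∀ f : (Fin m → ℝ) → ℝ, AnalyticAt ℝ f 0 → f 0 = 0 → LojasiewiczAt f 0) {r : ℕ}
    (hr : 1 ≤ r) (h : RealRootNear b r) : RealRootNear b (r + 1) := by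
  obtain ⟨F, C₂, hC₂, hFa, hF⟩ := exists_root_count_function d r
  obtain ⟨C₄, hC₄, θ₄, hθ₄, h₄⟩ := h
  have hFb0 : F (b 0) = 0 := by
    rw [(hF _).1, hb0]
    exact (card_roots_monicPoly_zero_le d).trans hr
  have hFba : AnalyticAt ℝ (fun x => F (b x)) 0 := (hFa (b 0)).comp hb
  obtain ⟨C₁, hC₁, θ₁, hθ₁, h₁⟩ := hm (fun x => F (b x)) hFba hFb0
  obtain ⟨K, t, ht, hK⟩ := (hb.contDiffAt (n := 1)).exists_lipschitzOnWith
  have hsmall : ∀ᶠ x in 𝓝 0, ∑ i, |b x i| ≤ 1 := by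
    have hcont : Tendsto (fun x => ∑ i, |b x i|) (𝓝 0) (𝓝 (∑ i, |b 0 i|)) :=
      tendsto_finsetSum _ fun i _ =>
        ((continuous_apply i).continuousAt.tendsto.comp hb.continuousAt.tendsto).abs
    rw [hb0] at hcont
    simp only [Pi.zero_apply, abs_zero, Finset.sum_const_zero] at hcont
    exact (hcont.eventually (gt_mem_nhds one_pos)).mono fun _ h => h.le
  obtain ⟨δ, hδ, hδb⟩ := Metric.eventually_nhds_iff_ball.1 (h₄.and (eventually_mem_set.2 ht))
  have hFsmall : ∀ᶠ x in 𝓝 0, C₁ * |F (b x)| ^ θ₁ < δ / 2 := by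
    have hcont : Tendsto (fun x => C₁ * |F (b x)| ^ θ₁) (𝓝 0) (𝓝 (C₁ * |F (b 0)| ^ θ₁)) :=
      (hFba.continuousAt.tendsto.abs.rpow_const (Or.inr hθ₁.le)).const_mul _
    rw [hFb0, abs_zero, Real.zero_rpow hθ₁.ne', mul_zero] at hcont
    exact hcont.eventually (gt_mem_nhds (half_pos hδ))
  set D₁ := C₁ * C₂ ^ θ₁ with hD₁
  have hD₁0 : 0 < D₁ := by positivity
  set D₃ := 1 * (d * K * D₁) ^ (1 / (d : ℝ)) with hD₃
  have hD₃0 : 0 ≤ D₃ := by positivity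
  set θ₂ := θ₁ * (1 / (d : ℝ)) with hθ₂
  have hθ₂0 : 0 < θ₂ := by positivity
  set θ₃ := min 1 θ₂ with hθ₃
  have hθ₃0 : 0 < θ₃ := lt_min one_pos hθ₂0
  set D₅ := C₄ * (1 + D₃) ^ θ₄ with hD₅
  have hD₅0 : 0 < D₅ := by positivity
  set θ := min (min θ₁ θ₂) (min θ₄ (θ₃ * θ₄)) with hθ
  have hθ0 : 0 < θ := lt_min (lt_min hθ₁ hθ₂0) (lt_min hθ₄ (by positivity))
  have hle1 : θ ≤ θ₁ := (min_le_left _ _).trans (min_le_left _ _)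
  have hle2 : θ ≤ θ₂ := (min_le_left _ _).trans (min_le_right _ _)
  have hle4 : θ ≤ θ₄ := (min_le_right _ _).trans (min_le_left _ _)
  have hle5 : θ ≤ θ₃ * θ₄ := (min_le_right _ _).trans (min_le_right _ _)
  refine ⟨C₄ + D₁ + D₃ + D₅, by positivity, θ, hθ0, ?_⟩
  filter_upwards [h₁, hsmall, hFsmall, Metric.ball_mem_nhds 0 (half_pos hδ)]
    with x ⟨x₁, hx₁, hxx₁⟩ hxs hxF hxδ z hz hcard
  by_cases him : z.im = 0
  · refine ⟨x, z.re, ?_, ?_, ?_⟩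
    · rw [exists_real_of_im_eq_zero him, hz]
    · simpa using by positivity
    · simpa [exists_real_of_im_eq_zero him] using by positivity
  have hz1 := norm_root_le_one hxs hz
  have he0 : 0 ≤ |z.im| := abs_nonneg _
  have he1 : |z.im| ≤ 1 := (Complex.abs_im_le_norm z).trans hz1
  have hxδ' : x ∈ Metric.ball 0 δ := Metric.ball_subset_ball (by linarith) hxδ
  rcases hcard.lt_or_eq with hlt | heq
  · obtain ⟨y, s, hys, hxy, hzs⟩ := (hδb x hxδ').1 z hz (Nat.lt_succ_iff.1 hlt)
    exact ⟨y, s, hys, le_mul_rpow_mono he0 he1 hC₄.le hθ0.le (by linarith) hle4 hxy,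
      le_mul_rpow_mono he0 he1 hC₄.le hθ0.le (by linarith) hle4 hzs⟩
  have hx₁δ : x₁ ∈ Metric.ball 0 δ := by
    rw [mem_ball_zero_iff] at hxδ ⊢
    calc ‖x₁‖ = ‖x - (x - x₁)‖ := by rw [sub_sub_cancel]
      _ ≤ ‖x‖ + ‖x - x₁‖ := norm_sub_le _ _
      _ < δ := by linarith
  have hFz : |F (b x)| ≤ C₂ * |z.im| ^ (1 : ℝ) := by
    rw [Real.rpow_one]
    exact (hF (b x)).2 heq hxs z hz him
  have e₁ : ‖x - x₁‖ ≤ D₁ * |z.im| ^ θ₁ := by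
    have := le_mul_rpow_trans (abs_nonneg _) he0 hC₁.le hC₂.le hθ₁.le hxx₁ hFz
    rwa [one_mul] at this
  obtain ⟨w, hw, hzw⟩ := exists_root_near (Nat.pos_of_ne_zero hd) (b x₁) z
  have e₂ : ‖(monicPoly (b x₁)).eval z‖ ≤ d * K * D₁ * |z.im| ^ θ₁ := by
    have h1 := norm_eval_monicPoly_sub_le (b x₁) (b x) hz1
    have h2 := hK.norm_sub_le (hδb x₁ hx₁δ).2 (hδb x hxδ').2
    rw [hz, sub_zero] at h1
    rw [norm_sub_rev x₁ x] at h2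
    calc ‖(monicPoly (b x₁)).eval z‖ ≤ d * (K * (D₁ * |z.im| ^ θ₁)) := by
          refine h1.trans ?_
          gcongr
          exact h2.trans (by gcongr)
      _ = _ := by ring
  have e₃ : ‖z - w‖ ≤ D₃ * |z.im| ^ θ₂ :=
    le_mul_rpow_trans (norm_nonneg _) he0 zero_le_one (by positivity) (by positivity)
      (le_rpow_one_div_of_pow_le hd (norm_nonneg _) hzw) e₂
  have hwim : |w.im| ≤ (1 + D₃) * |z.im| ^ θ₃ := by
    have h1 : |w.im| ≤ |z.im| + ‖z - w‖ := by
      have h2 := Complex.abs_im_le_norm (z - w)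
      have h3 := abs_sub_abs_le_abs_sub w.im z.im
      rw [Complex.sub_im, abs_sub_comm] at h2
      linarith
    have h2 : |z.im| ≤ 1 * |z.im| ^ θ₃ :=
      le_mul_rpow_mono he0 he1 zero_le_one hθ₃0.le le_rfl (min_le_left 1 θ₂) (by simp)
    have h3 : ‖z - w‖ ≤ D₃ * |z.im| ^ θ₃ :=
      le_mul_rpow_mono he0 he1 hD₃0 hθ₃0.le le_rfl (min_le_right _ _) e₃
    linarith
  obtain ⟨y, s, hys, hxy, hws⟩ := (hδb x₁ hx₁δ).1 w hw ((hF _).1.1 hx₁)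
  have e₄ := le_mul_rpow_trans (abs_nonneg _) he0 hC₄.le (by positivity) hθ₄.le hxy hwim
  have e₅ := le_mul_rpow_trans (abs_nonneg _) he0 hC₄.le (by positivity) hθ₄.le hws hwim
  have f₁ := le_mul_rpow_mono he0 he1 hD₁0.le hθ0.le le_rfl hle1 e₁
  have f₃ := le_mul_rpow_mono he0 he1 hD₃0 hθ0.le le_rfl hle2 e₃
  have f₄ := le_mul_rpow_mono he0 he1 hD₅0.le hθ0.le le_rfl hle5 e₄
  have f₅ := le_mul_rpow_mono he0 he1 hD₅0.le hθ0.le le_rfl hle5 e₅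
  have hpos : 0 ≤ |z.im| ^ θ := by positivity
  have hpos₄ := mul_nonneg hC₄.le hpos
  have hexp : (C₄ + D₁ + D₃ + D₅) * |z.im| ^ θ =
      C₄ * |z.im| ^ θ + D₁ * |z.im| ^ θ + D₃ * |z.im| ^ θ + D₅ * |z.im| ^ θ := by ring
  refine ⟨y, s, hys, ?_, ?_⟩
  · have := norm_sub_le_norm_sub_add_norm_sub x x₁ y
    have h2 := mul_nonneg hD₃0 hpos
    rw [hexp]
    linarith
  · have := norm_sub_le_norm_sub_add_norm_sub z w s
    have h2 := mul_nonneg hD₁0.le hpos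
    rw [hexp]
    linarith

theorem realRootNear {m d : ℕ} (hd : d ≠ 0) {b : (Fin m → ℝ) → (Fin d → ℝ)}
    (hb : AnalyticAt ℝ b 0) (hb0 : b 0 = 0)
    (hm : ∀ f : (Fin m → ℝ) → ℝ, AnalyticAt ℝ f 0 → f 0 = 0 → LojasiewiczAt f 0) {r : ℕ}
    (hr : 1 ≤ r) : RealRootNear b r := by
  induction r, hr using Nat.le_induction with
  | base => exact realRootNear_one b
  | succ r hr ih => exact ih.succ hd hb hb0 hm hr

theorem LojasiewiczAt.of_comp_equiv {E F : Type*} [NormedAddCommGroup E] [NormedSpace ℝ E]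
    [NormedAddCommGroup F] [NormedSpace ℝ F] (e : E ≃L[ℝ] F) {f : F → ℝ} {a : F}
    (h : LojasiewiczAt (fun x => f (a + e x)) 0) : LojasiewiczAt f a := by
  obtain ⟨C, hC, θ, hθ, h⟩ := h
  refine ⟨(‖(e : E →L[ℝ] F)‖ + 1) * C, by positivity, θ, hθ, ?_⟩
  have ht : Tendsto (fun x => e.symm (x - a)) (𝓝 a) (𝓝 0) := by
    have : Continuous fun x => e.symm (x - a) := by fun_prop
    simpa using this.tendsto a
  filter_upwards [ht.eventually h] with x ⟨s, hs, hxs⟩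
  refine ⟨a + e s, hs, ?_⟩
  rw [e.apply_symm_apply, add_sub_cancel] at hxs
  have h1 : x - (a + e s) = (e : E →L[ℝ] F) (e.symm (x - a) - s) := by
    simp [sub_sub]
  rw [h1]
  calc ‖(e : E →L[ℝ] F) (e.symm (x - a) - s)‖
      ≤ ‖(e : E →L[ℝ] F)‖ * ‖e.symm (x - a) - s‖ := ContinuousLinearMap.le_opNorm _ _
    _ ≤ (‖(e : E →L[ℝ] F)‖ + 1) * (C * |f x| ^ θ) := by
        gcongr
        linarith
    _ = _ := by ring

theorem lojasiewiczAt_of_regular {m : ℕ} {f : (Fin (m + 1) → ℝ) → ℝ}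
    {p : FormalMultilinearSeries ℝ (Fin (m + 1) → ℝ) ℝ} (hf : HasFPowerSeriesAt f p 0)
    (hf0 : f 0 = 0) (hreg : ∃ n, p n (fun _ => Pi.single 0 1) ≠ 0)
    (hm : ∀ g : (Fin m → ℝ) → ℝ, AnalyticAt ℝ g 0 → g 0 = 0 → LojasiewiczAt g 0) :
    LojasiewiczAt f 0 := by
  classical
  obtain ⟨d, hd, hlow⟩ : ∃ d, p d (fun _ => Pi.single 0 1) ≠ 0 ∧
      ∀ k < d, p k (fun _ => Pi.single 0 1) = 0 :=
    ⟨Nat.find hreg, Nat.find_spec hreg, fun k hk => not_not.1 (Nat.find_min hreg hk)⟩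
  have hd0 : d ≠ 0 := by
    rintro rfl
    exact hd (by rw [hf.coeff_zero, hf0])
  obtain ⟨r, hr, κ, hκ, b, hb, hb0, hW⟩ := weierstrass_preparation hf hlow hd
  obtain ⟨C, hC, η, hη, hR⟩ := realRootNear hd0 hb hb0 hm (Nat.one_le_iff_ne_zero.2 hd0)
  obtain ⟨δ, hδ, hδW⟩ := Metric.eventually_nhds_iff_ball.1 hW
  set D₁ := 1 * (2 * |κ|) ^ (1 / (d : ℝ)) with hD₁
  have hD₁0 : 0 < D₁ := by positivity
  set θ₁ := 1 * (1 / (d : ℝ)) with hθ₁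
  have hθ₁0 : 0 < θ₁ := by positivity
  set D₂ := C * D₁ ^ η with hD₂
  have hD₂0 : 0 < D₂ := by positivity
  set θ := min θ₁ (θ₁ * η) with hθ
  have hθ0 : 0 < θ := lt_min hθ₁0 (by positivity)
  have hfc : Tendsto f (𝓝 0) (𝓝 0) := by
    simpa [hf0] using hf.continuousAt.tendsto
  have hfsmall : ∀ᶠ X in 𝓝 0, |f X| < 1 := by
    have := hfc.abs
    rw [abs_zero] at this
    exact this.eventually (gt_mem_nhds one_pos)
  have hfsmall' : ∀ᶠ X in 𝓝 0, (D₁ + D₂) * |f X| ^ θ < min (δ / 2) (1 / 4) := by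
    have := (hfc.abs.rpow_const (p := θ) (Or.inr hθ0.le)).const_mul (D₁ + D₂)
    rw [abs_zero, Real.zero_rpow hθ0.ne', mul_zero] at this
    exact this.eventually (gt_mem_nhds (by positivity))
  have htail : Tendsto (fun X : Fin (m + 1) → ℝ => Fin.tail X) (𝓝 0) (𝓝 0) := by
    have : Continuous fun X : Fin (m + 1) → ℝ => Fin.tail X :=
      continuous_pi fun i => continuous_apply _
    exact this.tendsto 0
  have hhead : Tendsto (fun X : Fin (m + 1) → ℝ => |X 0 / r|) (𝓝 0) (𝓝 0) := by
    have : Continuous fun X : Fin (m + 1) → ℝ => |X 0 / r| := by fun_prop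
    simpa using this.tendsto 0
  refine ⟨(r + 1) * (D₁ + D₂), by positivity, θ, hθ0, ?_⟩
  filter_upwards [hfsmall, hfsmall', htail.eventually hR,
    htail.eventually (Metric.ball_mem_nhds 0 (half_pos hδ)),
    hhead.eventually (gt_mem_nhds (by norm_num : (0 : ℝ) < 1 / 4))]
    with X hX1 hXθ hXR hXδ hXs
  set x := Fin.tail X with hx
  set s := X 0 / r with hs
  have hX : Fin.cons (r * s) x = X := by
    rw [hs, mul_div_cancel₀ _ hr.ne', hx, Fin.cons_self_tail]
  have hXδ' : x ∈ Metric.ball 0 δ := Metric.ball_subset_ball (by linarith) hXδ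
  have hlin : ∀ (y : Fin m → ℝ) (t : ℝ), (monicPoly (b y)).eval (t : ℂ) =
      ((t ^ d + ∑ i, b y i * t ^ (i : ℕ) : ℝ) : ℂ) := by
    intro y t
    rw [eval_monicPoly]
    push_cast
    rfl
  have e₀ : ‖(monicPoly (b x)).eval (s : ℂ)‖ ≤ 2 * |κ| * |f X| ^ (1 : ℝ) := by
    obtain ⟨v, -, hv2, hv⟩ := hδW x hXδ' s (by linarith)
    rw [hlin, Complex.norm_real, hv, hX, Real.norm_eq_abs, abs_mul, abs_mul, Real.rpow_one]
    gcongr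
  obtain ⟨z, hz, hsz⟩ := exists_root_near (Nat.pos_of_ne_zero hd0) (b x) s
  have e₁ : ‖(s : ℂ) - z‖ ≤ D₁ * |f X| ^ θ₁ :=
    le_mul_rpow_trans (norm_nonneg _) (abs_nonneg _) zero_le_one (by positivity) (by positivity)
      (le_rpow_one_div_of_pow_le hd0 (norm_nonneg _) hsz) e₀
  have him : |z.im| ≤ D₁ * |f X| ^ θ₁ := by
    have h1 := Complex.abs_im_le_norm ((s : ℂ) - z)
    rw [Complex.sub_im, Complex.ofReal_im, zero_sub, abs_neg] at h1
    exact h1.trans e₁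
  have hcard : (monicPoly (b x)).roots.toFinset.card ≤ d := by
    refine (Multiset.toFinset_card_le _).trans ((Polynomial.card_roots' _).trans ?_)
    rw [natDegree_monicPoly]
  obtain ⟨y, t, hyt, hxy, hzt⟩ := hXR z hz hcard
  have f₁ := le_mul_rpow_mono (abs_nonneg _) hX1.le hD₁0.le hθ0.le le_rfl (min_le_left _ _) e₁
  have f₂ := le_mul_rpow_mono (abs_nonneg _) hX1.le hD₂0.le hθ0.le le_rfl (min_le_right _ _)
    (le_mul_rpow_trans (abs_nonneg _) (abs_nonneg _) hC.le hD₁0.le hη.le hxy him)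
  have f₃ := le_mul_rpow_mono (abs_nonneg _) hX1.le hD₂0.le hθ0.le le_rfl (min_le_right _ _)
    (le_mul_rpow_trans (abs_nonneg _) (abs_nonneg _) hC.le hD₁0.le hη.le hzt him)
  have hpos : 0 ≤ D₁ * |f X| ^ θ := by positivity
  have hxy' : ‖x - y‖ ≤ (D₁ + D₂) * |f X| ^ θ := by
    rw [add_mul]
    linarith
  have hst : |s - t| ≤ (D₁ + D₂) * |f X| ^ θ := by
    have h1 := norm_sub_le_norm_sub_add_norm_sub (s : ℂ) z t
    rw [← Complex.ofReal_sub, Complex.norm_real, Real.norm_eq_abs] at h1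
    rw [add_mul]
    linarith
  have ht : |t| ≤ 1 / 2 := by
    have h1 := abs_sub_abs_le_abs_sub t s
    rw [abs_sub_comm] at h1
    have h2 := hXθ.trans_le (min_le_right _ _)
    linarith
  have hy : y ∈ Metric.ball 0 δ := by
    have h2 := hXθ.trans_le (min_le_left _ _)
    rw [dist_zero_right] at hXδ
    rw [mem_ball_zero_iff]
    calc ‖y‖ = ‖x - (x - y)‖ := by rw [sub_sub_cancel]
      _ ≤ ‖x‖ + ‖x - y‖ := norm_sub_le _ _
      _ < δ := by linarith
  refine ⟨Fin.cons (r * t) y, ?_, ?_⟩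
  · obtain ⟨v, hv, -, hvf⟩ := hδW y hy t ht
    rw [hlin, Complex.ofReal_eq_zero, hvf, mul_eq_zero, mul_eq_zero] at hyt
    rcases hyt with (h | h) | h
    · rw [h, abs_zero] at hv
      norm_num at hv
    · exact absurd h hκ
    · exact h
  · have hnn : 0 ≤ (D₁ + D₂) * |f X| ^ θ := by positivity
    rw [mul_assoc, pi_norm_le_iff_of_nonneg (by positivity)]
    intro i
    refine Fin.cases ?_ (fun j => ?_) i
    · have h0 : X 0 = r * s := by rw [hs, mul_div_cancel₀ _ hr.ne']
      rw [Pi.sub_apply, Fin.cons_zero, h0, ← mul_sub, Real.norm_eq_abs, abs_mul, abs_of_pos hr]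
      nlinarith [mul_le_mul_of_nonneg_left hst hr.le]
    · rw [Pi.sub_apply, Fin.cons_succ]
      have : ‖X j.succ - y j‖ ≤ (D₁ + D₂) * |f X| ^ θ := (norm_le_pi_norm (x - y) j).trans hxy'
      nlinarith [mul_nonneg hr.le hnn]

/-- The local Łojasiewicz inequality for real-analytic functions. -/
theorem lojasiewiczAt_zero : ∀ (m : ℕ) (f : (Fin m → ℝ) → ℝ), AnalyticAt ℝ f 0 → f 0 = 0 →
    LojasiewiczAt f 0 := by
  intro m
  induction m with
  | zero =>
    intro f _ hf0
    refine ⟨1, one_pos, 1, one_pos, Eventually.of_forall fun x => ⟨x, ?_, ?_⟩⟩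
    · rw [Subsingleton.elim x 0, hf0]
    · rw [sub_self, norm_zero]
      positivity
  | succ m ih =>
    rintro f ⟨p, hp⟩ hf0
    by_cases hall : ∀ n v, p n (fun _ => v) = 0
    · refine ⟨1, one_pos, 1, one_pos, ?_⟩
      filter_upwards [hp.eventually_hasSum] with x hx
      refine ⟨x, ?_, by simp⟩
      simp only [hall, zero_add] at hx
      exact hx.unique hasSum_zero
    · push Not at hall
      obtain ⟨n, v, hnv⟩ := hall
      have hn : n ≠ 0 := by
        rintro rfl
        exact hnv (by rw [hp.coeff_zero, hf0])
      have hv : v ≠ 0 := by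
        rintro rfl
        exact hnv ((p n).map_coord_zero ⟨0, Nat.pos_of_ne_zero hn⟩ rfl)
      have hsingle : (Pi.single 0 1 : Fin (m + 1) → ℝ) ≠ 0 := by simp
      obtain ⟨e, he⟩ := SeparatingDual.exists_continuousLinearEquiv_apply_eq (R := ℝ) hsingle hv
      refine LojasiewiczAt.of_comp_equiv e ?_
      simp only [zero_add]
      have hp' : HasFPowerSeriesAt f p ((e : (Fin (m + 1) → ℝ) →L[ℝ] (Fin (m + 1) → ℝ)) 0) := by
        simpa using hp
      refine lojasiewiczAt_of_regular (p := p.compContinuousLinearMap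
        (e : (Fin (m + 1) → ℝ) →L[ℝ] (Fin (m + 1) → ℝ))) hp'.compContinuousLinearMap
        (by simpa using hf0) ⟨n, ?_⟩ ih
      simpa [Function.comp_def, he] using hnv

theorem exists_holder_near {n : ℕ} {U : Set (EuclideanSpace ℝ (Fin n))} (hU : IsOpen U)
    {f : EuclideanSpace ℝ (Fin n) → ℝ} (hf : AnalyticOnNhd ℝ f U)
    {a : EuclideanSpace ℝ (Fin n)} (ha : a ∈ U) :
    ∃ σ > (0 : ℝ), ∃ L > (0 : ℝ), ∃ θ > (0 : ℝ), ∀ᶠ x in 𝓝 a, |f x| ≤ σ →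
      ∃ s, (s ∈ U ∧ f s = 0) ∧ ‖x - s‖ ≤ L * |f x| ^ θ := by
  by_cases hfa : f a = 0
  · have hloj : LojasiewiczAt f a := by
      refine LojasiewiczAt.of_comp_equiv (EuclideanSpace.equiv (Fin n) ℝ).symm
        (lojasiewiczAt_zero n _ ?_ (by simpa using hfa))
      refine AnalyticAt.comp (g := f) (f := fun x => a + (EuclideanSpace.equiv (Fin n) ℝ).symm x)
        (by simpa using hf a ha) ?_
      exact analyticAt_const.add ((EuclideanSpace.equiv (Fin n) ℝ).symm.analyticAt 0)
    obtain ⟨C, hC, θ, hθ, h⟩ := hloj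
    obtain ⟨δ, hδ, hδU⟩ := Metric.isOpen_iff.1 hU a ha
    have hfsmall : ∀ᶠ x in 𝓝 a, C * |f x| ^ θ < δ / 2 := by
      have := ((hf a ha).continuousAt.tendsto.abs.rpow_const (p := θ) (Or.inr hθ.le)).const_mul C
      rw [hfa, abs_zero, Real.zero_rpow hθ.ne', mul_zero] at this
      exact this.eventually (gt_mem_nhds (half_pos hδ))
    refine ⟨1, one_pos, C, hC, θ, hθ, ?_⟩
    filter_upwards [h, hfsmall, Metric.ball_mem_nhds a (half_pos hδ)] with x ⟨s, hs, hxs⟩ hx hxa _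
    refine ⟨s, ⟨hδU ?_, hs⟩, hxs⟩
    rw [Metric.mem_ball] at hxa ⊢
    have := dist_triangle s x a
    rw [dist_comm s x, dist_eq_norm x s] at this
    linarith
  · refine ⟨|f a| / 2, by positivity, 1, one_pos, 1, one_pos, ?_⟩
    have : |f a| / 2 < |f a| := by
      have := abs_pos.2 hfa
      linarith
    filter_upwards [(hf a ha).continuousAt.tendsto.abs.eventually (lt_mem_nhds this)] with x hx hx'
    exact absurd hx (not_lt.2 hx')

end

/-- Let `f` be real-analytic on an open set `U ⊆ ℝⁿ` with nonempty zero
set `S = {x ∈ U | f x = 0}`. Then the solution mapping `y ↦ {x ∈ U | f x = y}` is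
compactly R-Hölder continuous at `0`: for every compact `K ⊆ U` there are
`σ, L, θ > 0` such that `{x ∈ K | f x = y} ⊆ S + L|y|^θ·𝔹` whenever `|y| ≤ σ`. -/
theorem compactRHolder_of_analytic
    {n : ℕ} (U : Set (EuclideanSpace ℝ (Fin n))) (hU : IsOpen U)
    (f : EuclideanSpace ℝ (Fin n) → ℝ)
    (hf : AnalyticOnNhd ℝ f U)
    (hS : {x | x ∈ U ∧ f x = 0}.Nonempty) :
    ∀ K : Set (EuclideanSpace ℝ (Fin n)), IsCompact K → K ⊆ U →
      ∃ σ > (0 : ℝ), ∃ L > (0 : ℝ), ∃ θ > (0 : ℝ),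
        ∀ y : ℝ, |y| ≤ σ → ∀ x ∈ K, f x = y →
          ∃ s : EuclideanSpace ℝ (Fin n), (s ∈ U ∧ f s = 0) ∧ ‖x - s‖ ≤ L * |y| ^ θ := by
  intro K hK hKU
  suffices h : ∃ σ > (0 : ℝ), ∃ L > (0 : ℝ), ∃ θ > (0 : ℝ), ∀ x ∈ K, |f x| ≤ σ →
      ∃ s, (s ∈ U ∧ f s = 0) ∧ ‖x - s‖ ≤ L * |f x| ^ θ by
    obtain ⟨σ, hσ, L, hL, θ, hθ, h⟩ := h
    refine ⟨σ, hσ, L, hL, θ, hθ, fun y hy x hx hxy => ?_⟩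
    subst hxy
    exact h x hx hy
  refine hK.induction_on (p := fun A => ∃ σ > (0 : ℝ), ∃ L > (0 : ℝ), ∃ θ > (0 : ℝ),
    ∀ x ∈ A, |f x| ≤ σ → ∃ s, (s ∈ U ∧ f s = 0) ∧ ‖x - s‖ ≤ L * |f x| ^ θ) ?_ ?_ ?_ ?_
  · exact ⟨1, one_pos, 1, one_pos, 1, one_pos, fun x hx => absurd hx (Set.notMem_empty x)⟩
  · rintro A B hAB ⟨σ, hσ, L, hL, θ, hθ, h⟩
    exact ⟨σ, hσ, L, hL, θ, hθ, fun x hx => h x (hAB hx)⟩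
  · rintro A B ⟨σ₁, hσ₁, L₁, hL₁, θ₁, hθ₁, h₁⟩ ⟨σ₂, hσ₂, L₂, hL₂, θ₂, hθ₂, h₂⟩
    refine ⟨min 1 (min σ₁ σ₂), by positivity, L₁ + L₂, by positivity, min θ₁ θ₂, by positivity,
      fun x hx hxσ => ?_⟩
    have hx1 : |f x| ≤ 1 := hxσ.trans (min_le_left _ _)
    have hθ0 : 0 ≤ min θ₁ θ₂ := by positivity
    rcases hx with hx | hx
    · obtain ⟨s, hs, hxs⟩ := h₁ x hx (hxσ.trans ((min_le_right _ _).trans (min_le_left _ _)))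
      exact ⟨s, hs, le_mul_rpow_mono (abs_nonneg _) hx1 hL₁.le hθ0 (by linarith)
        (min_le_left _ _) hxs⟩
    · obtain ⟨s, hs, hxs⟩ := h₂ x hx (hxσ.trans ((min_le_right _ _).trans (min_le_right _ _)))
      exact ⟨s, hs, le_mul_rpow_mono (abs_nonneg _) hx1 hL₂.le hθ0 (by linarith)
        (min_le_right _ _) hxs⟩
  · intro a ha
    obtain ⟨σ, hσ, L, hL, θ, hθ, h⟩ := exists_holder_near hU hf (hKU ha)
    exact ⟨_, mem_nhdsWithin_of_mem_nhds h, σ, hσ, L, hL, θ, hθ, fun x hx => hx⟩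
end

section
/- Let f : ℝ → ℝ be defined by f(x) = exp(−1/x²) for x ≠ 0 and f(0) = 0, whose zero set is S = {0}. Then: (a) the inverse mapping f⁻¹ : y ↦ {x ∈ ℝ | f(x) = y} is R-continuous at 0, i.e., there exist σ > 0 and a nondecreasing function ρ : [0,∞) → [0,∞) with ρ(0) = 0 and ρ(r) → 0 as r → 0⁺ such that for all y with |y| ≤ σ and all x with f(x) = y one has |x| ≤ ρ(|y|); and (b) f does not satisfy the Łojasiewicz inequality at 0: for every θ > 0 and c > 0 there exists x ∈ [−1,1] with |x|^θ > c·|f(x)|. -/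
open Filter Set

/-- The function `f(x) = exp(-1/x²)` for `x ≠ 0`, `f(0) = 0`. -/
noncomputable def fexp (x : ℝ) : ℝ := if x = 0 then 0 else Real.exp (-(1 / x ^ 2))

/-- The modulus `r ↦ 1 / √(-log r)`, frozen at `r = exp (-1)` so as to be monotone on `[0, ∞)`. -/
noncomputable def fexpModulus (r : ℝ) : ℝ := √(-Real.log (min r (Real.exp (-1))))⁻¹

lemma fexpModulus_nonneg (r : ℝ) : 0 ≤ fexpModulus r := Real.sqrt_nonneg _

lemma fexpModulus_zero : fexpModulus 0 = 0 := by
  simp [fexpModulus, min_eq_left (Real.exp_pos (-1)).le]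

lemma fexpModulus_mono {r s : ℝ} (hr : 0 ≤ r) (hrs : r ≤ s) : fexpModulus r ≤ fexpModulus s := by
  rcases hr.eq_or_lt with rfl | hr
  · simpa only [fexpModulus_zero] using fexpModulus_nonneg s
  · have hpos : 0 < min r (Real.exp (-1)) := lt_min hr (Real.exp_pos _)
    have hle : min r (Real.exp (-1)) ≤ min s (Real.exp (-1)) := min_le_min_right _ hrs
    have hlog : Real.log (min s (Real.exp (-1))) ≤ -1 :=
      (Real.log_le_iff_le_exp (hpos.trans_le hle)).2 (min_le_right _ _)
    have hlog_le := Real.log_le_log hpos hle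
    exact Real.sqrt_le_sqrt (inv_anti₀ (by linarith) (by linarith))

lemma tendsto_fexpModulus : Tendsto fexpModulus (nhdsWithin 0 (Ioi 0)) (nhds 0) := by
  have h : Tendsto (fun r : ℝ => √(-Real.log r)⁻¹) (nhdsWithin 0 (Ioi 0)) (nhds 0) := by
    simpa using (tendsto_inv_atTop_zero.comp
      (tendsto_neg_atBot_atTop.comp Real.tendsto_log_nhdsGT_zero)).sqrt
  refine h.congr' ?_
  filter_upwards [Ioo_mem_nhdsGT (Real.exp_pos (-1))] with r hr
  rw [fexpModulus, min_eq_left hr.2.le]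

lemma fexp_nonneg (x : ℝ) : 0 ≤ fexp x := by
  unfold fexp
  split_ifs
  exacts [le_rfl, (Real.exp_pos _).le]

lemma abs_eq_fexpModulus_fexp {x : ℝ} (hx : fexp x ≤ Real.exp (-1)) :
    |x| = fexpModulus (fexp x) := by
  rw [fexpModulus, min_eq_left hx]
  by_cases h : x = 0
  · simp [fexp, h]
  · simp [fexp, h, Real.sqrt_sq_eq_abs]

lemma exists_mul_fexp_lt_rpow (θ : ℝ) {c : ℝ} (hc : 0 < c) :
    ∃ x ∈ Icc (-1 : ℝ) 1, c * |fexp x| < |x| ^ θ := by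
  have hlim := tendsto_rpow_mul_exp_neg_mul_atTop_nhds_zero θ 1 one_pos
  obtain ⟨u, hu, hu1⟩ :=
    ((hlim.eventually (gt_mem_nhds (inv_pos.2 hc))).and (eventually_ge_atTop 1)).exists
  have hu0 : 0 < u := one_pos.trans_le hu1
  have hinv : 0 < u⁻¹ := inv_pos.2 hu0
  refine ⟨u⁻¹, ⟨by linarith, inv_le_one_of_one_le₀ hu1⟩, ?_⟩
  have hf : fexp u⁻¹ ≤ Real.exp (-1 * u) := by
    rw [fexp, if_neg hinv.ne', Real.exp_le_exp, inv_pow, one_div, inv_inv]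
    nlinarith
  rw [abs_of_nonneg (fexp_nonneg _), abs_of_pos hinv, Real.inv_rpow hu0.le]
  have hpow : 0 < u ^ θ := Real.rpow_pos_of_pos hu0 θ
  calc c * fexp u⁻¹ ≤ c * Real.exp (-1 * u) := by gcongr
    _ < (u ^ θ)⁻¹ := by
      rw [lt_inv_comm₀ (by positivity) hpow, mul_inv, ← div_eq_mul_inv, lt_div_iff₀ (Real.exp_pos _)]
      exact hu

/-- For `f(x) = exp(-1/x²)` (with `f(0) = 0`, zero set `S = {0}`):
(a) the inverse mapping `y ↦ {x | f x = y}` is R-continuous at `0`;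
(b) `f` fails the Łojasiewicz inequality: for all `θ, c > 0` there is `x ∈ [-1,1]`
with `|x|^θ > c·|f x|`. -/
theorem fexp_rContinuous_not_lojasiewicz :
    (∃ σ > (0 : ℝ), ∃ ρ : ℝ → ℝ,
      (∀ r, 0 ≤ r → 0 ≤ ρ r) ∧
      (∀ r s, 0 ≤ r → r ≤ s → ρ r ≤ ρ s) ∧
      ρ 0 = 0 ∧
      Tendsto ρ (nhdsWithin 0 (Ioi 0)) (nhds 0) ∧
      ∀ y : ℝ, |y| ≤ σ → ∀ x : ℝ, fexp x = y → |x| ≤ ρ |y|) ∧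
    (∀ θ > (0 : ℝ), ∀ c > (0 : ℝ), ∃ x ∈ Icc (-1 : ℝ) 1, |x| ^ θ > c * |fexp x|) := by
  refine ⟨⟨Real.exp (-1), Real.exp_pos _, fexpModulus, fun r _ => fexpModulus_nonneg r,
    fun r s => fexpModulus_mono, fexpModulus_zero, tendsto_fexpModulus, ?_⟩,
    fun θ _ c hc => exists_mul_fexp_lt_rpow θ hc⟩
  rintro y hy x rfl
  rw [abs_of_nonneg (fexp_nonneg x)] at hy ⊢
  exact (abs_eq_fexpModulus_fexp hy).le
end

section
/- Define A : ℝ ⇒ ℝ by A(0) = {0} and A(x) = {x, 1/x} for x ≠ 0. Then: (a) A is compactly R-Lipschitz continuous at 0: for every compact set K ⊆ ℝ there exist σ > 0 and L > 0 such that for all x with |x| ≤ σ, every y ∈ A(x) ∩ K satisfies |y| ≤ L|x|; and (b) A is not R-continuous at 0: there do not exist σ > 0 and a nondecreasing function ρ : [0,∞) → [0,∞) with ρ(0) = 0 and ρ(r) → 0 as r → 0⁺ such that every y ∈ A(x) satisfies |y| ≤ ρ(|x|) whenever |x| ≤ σ. -/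
open Filter Set

/-- The set-valued mapping `A(0) = {0}`, `A(x) = {x, 1/x}` for `x ≠ 0`. -/
noncomputable def Aex (x : ℝ) : Set ℝ := if x = 0 then {0} else {x, 1 / x}

theorem lt_abs_one_div_of_abs_le {x C : ℝ} (hC : 0 ≤ C) (hx : x ≠ 0)
    (h : |x| ≤ 1 / (C + 1)) : C < |1 / x| := by
  have hle : C + 1 ≤ 1 / |x| := (le_one_div (abs_pos.mpr hx) (by positivity)).mp h
  rw [abs_div, abs_one]
  linarith

/-- For `A(0) = {0}` and `A(x) = {x, 1/x}` (`x ≠ 0`):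
(a) `A` is compactly R-Lipschitz continuous at `0`: for every compact `K ⊆ ℝ` there exist
`σ > 0` and `L > 0` such that `|y| ≤ L|x|` for all `|x| ≤ σ` and `y ∈ A(x) ∩ K`;
(b) `A` is not R-continuous at `0`. -/
theorem Aex_compactRLipschitz_not_rContinuous :
    (∀ K : Set ℝ, IsCompact K → ∃ σ > (0 : ℝ), ∃ L > (0 : ℝ),
      ∀ x : ℝ, |x| ≤ σ → ∀ y ∈ Aex x ∩ K, |y| ≤ L * |x|) ∧
    ¬ (∃ σ > (0 : ℝ), ∃ ρ : ℝ → ℝ,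
      (∀ r, 0 ≤ r → 0 ≤ ρ r) ∧
      (∀ r s, 0 ≤ r → r ≤ s → ρ r ≤ ρ s) ∧
      ρ 0 = 0 ∧
      Tendsto ρ (nhdsWithin 0 (Ioi 0)) (nhds 0) ∧
      ∀ x : ℝ, |x| ≤ σ → ∀ y ∈ Aex x, |y| ≤ ρ |x|) := by
  constructor
  · intro K hK
    obtain ⟨C, hC, hKC⟩ := hK.isBounded.exists_pos_norm_le
    refine ⟨1 / (C + 1), by positivity, 1, one_pos, ?_⟩
    rintro x hx y ⟨hy, hyK⟩
    have hyC : |y| ≤ C := hKC y hyK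
    rw [one_mul]
    by_cases h0 : x = 0
    · simp_all [Aex]
    · simp only [Aex, if_neg h0, mem_insert_iff, mem_singleton_iff] at hy
      rcases hy with rfl | rfl
      · exact le_rfl
      · exact absurd hyC (lt_abs_one_div_of_abs_le hC.le h0 hx).not_ge
  · rintro ⟨σ, hσ, ρ, hnonneg, hmono, -, -, h⟩
    have hρ : 0 ≤ ρ σ := hnonneg σ hσ.le
    have hpos : 0 < min σ (1 / (ρ σ + 1)) := lt_min hσ (by positivity)
    set x := min σ (1 / (ρ σ + 1))
    have habs : |x| = x := abs_of_pos hpos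
    have hxσ : |x| ≤ σ := habs.trans_le (min_le_left _ _)
    have hmem : 1 / x ∈ Aex x := by simp [Aex, hpos.ne']
    have hlt := lt_abs_one_div_of_abs_le hρ hpos.ne' (habs.trans_le (min_le_right _ _))
    exact hlt.not_ge ((h x hxσ _ hmem).trans (hmono _ _ (abs_nonneg x) hxσ))
end

section
/- Let f : ℝⁿ → ℝ be differentiable with inf_{x ∈ ℝⁿ} f(x) > −∞, and let (x_k) be a sequence in ℝⁿ such that for some α, β > 0 and all k: (H1) f(x_k) − f(x_{k+1}) ≥ α‖x_{k+1} − x_k‖², and (H2) ‖∇f(x_{k+1})‖ ≤ β‖x_{k+1} − x_k‖. Suppose the set of stationary points S := {x ∈ ℝⁿ | ∇f(x) = 0} is nonempty and the inverse gradient mapping (∇f)⁻¹ : y ↦ {x ∈ ℝⁿ | ∇f(x) = y} is R-continuous at 0. Then dist(x_k, S) → 0 as k → ∞. -/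
open Filter Set

/-- Sufficient decrease of a function bounded below forces consecutive iterates together. -/
theorem tendsto_norm_sub_of_sufficient_decrease {E : Type*} [SeminormedAddCommGroup E]
    {f : E → ℝ} (hbdd : BddBelow (Set.range f)) {x : ℕ → E} {α : ℝ} (hα : 0 < α)
    (h : ∀ k : ℕ, f (x k) - f (x (k + 1)) ≥ α * ‖x (k + 1) - x k‖ ^ 2) :
    Tendsto (fun k => ‖x (k + 1) - x k‖) atTop (nhds 0) := by
  have hanti : Antitone (fun k => f (x k)) := antitone_nat_of_succ_le fun k => by
    have := mul_nonneg hα.le (sq_nonneg ‖x (k + 1) - x k‖)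
    linarith [h k]
  have hlim := tendsto_atTop_ciInf hanti (hbdd.mono (Set.range_comp_subset_range x f))
  have hdiff : Tendsto (fun k => (f (x k) - f (x (k + 1))) / α) atTop (nhds 0) := by
    simpa using (hlim.sub (hlim.comp (tendsto_add_atTop_nat 1))).div_const α
  have hsq : Tendsto (fun k => ‖x (k + 1) - x k‖ ^ 2) atTop (nhds 0) :=
    squeeze_zero (fun k => sq_nonneg _)
      (fun k => (le_div_iff₀' hα).2 (h k)) hdiff
  simpa [Real.sqrt_sq] using hsq.sqrt

/-- Descent method under (H1)–(H2): if `f : ℝⁿ → ℝ` is differentiable and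
bounded below, `(x_k)` satisfies the sufficient decrease and relative error conditions,
the stationary set `S = (∇f)⁻¹(0)` is nonempty, and `(∇f)⁻¹` is R-continuous at `0`,
then `dist(x_k, S) → 0`. -/
theorem descent_convergence_of_rContinuous
    {n : ℕ} (f : EuclideanSpace ℝ (Fin n) → ℝ)
    (hf : Differentiable ℝ f)
    (hbdd : BddBelow (Set.range f))
    (x : ℕ → EuclideanSpace ℝ (Fin n)) (α β : ℝ) (hα : 0 < α) (hβ : 0 < β)
    (hH1 : ∀ k : ℕ, f (x k) - f (x (k + 1)) ≥ α * ‖x (k + 1) - x k‖ ^ 2)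
    (hH2 : ∀ k : ℕ, ‖gradient f (x (k + 1))‖ ≤ β * ‖x (k + 1) - x k‖)
    (S : Set (EuclideanSpace ℝ (Fin n)))
    (hSdef : S = {z | gradient f z = 0}) (hSne : S.Nonempty)
    (hR : ∃ σ > (0 : ℝ), ∃ ρ : ℝ → ℝ,
      (∀ r, 0 ≤ r → 0 ≤ ρ r) ∧
      (∀ r s, 0 ≤ r → r ≤ s → ρ r ≤ ρ s) ∧
      ρ 0 = 0 ∧
      Tendsto ρ (nhdsWithin 0 (Ioi 0)) (nhds 0) ∧
      ∀ y : EuclideanSpace ℝ (Fin n), ‖y‖ ≤ σ →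
        ∀ z : EuclideanSpace ℝ (Fin n), gradient f z = y →
          Metric.infDist z S ≤ ρ ‖y‖) :
    Tendsto (fun k => Metric.infDist (x k) S) atTop (nhds 0) := by
  obtain ⟨σ, hσ, ρ, -, -, hρ0, hρ, hdist⟩ := hR
  have hgrad : Tendsto (fun k => ‖gradient f (x (k + 1))‖) atTop (nhds 0) :=
    squeeze_zero (fun k => norm_nonneg _) hH2 <| by
      simpa using (tendsto_norm_sub_of_sufficient_decrease hbdd hα hH1).const_mul β
  have hρ' : Tendsto ρ (nhdsWithin 0 (Ici 0)) (nhds 0) := by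
    rw [← Ioi_insert, nhdsWithin_insert, tendsto_sup, tendsto_pure_left]
    exact ⟨fun s hs => hρ0.symm ▸ mem_of_mem_nhds hs, hρ⟩
  have hlim : Tendsto (fun k => ρ ‖gradient f (x (k + 1))‖) atTop (nhds 0) :=
    hρ'.comp <| tendsto_nhdsWithin_iff.2 ⟨hgrad, .of_forall fun _ => norm_nonneg _⟩
  rw [← tendsto_add_atTop_iff_nat 1]
  refine squeeze_zero' (.of_forall fun _ => Metric.infDist_nonneg) ?_ hlim
  filter_upwards [hgrad.eventually_le_const hσ] with k hk
  exact hdist _ hk _ rfl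
end

section
/- Let A : ℝⁿ ⇒ ℝⁿ be a set-valued mapping whose graph {(x, y) | y ∈ A(x)} is closed in ℝⁿ × ℝⁿ and whose inverse A⁻¹ is locally bounded around 0, i.e., there exists σ₀ > 0 such that the set {x ∈ ℝⁿ | ∃ y, ‖y‖ ≤ σ₀ and y ∈ A(x)} is bounded. Suppose the solution set S := {x ∈ ℝⁿ | 0 ∈ A(x)} is nonempty, and let (x_k), (w_k) be sequences with w_k ∈ A(x_k) for all k and ‖w_k‖ ≤ α·ξ(k)^β for some α, β > 0 and some function ξ : ℕ → [0,∞) with ξ(k) → 0 as k → ∞. Then dist(x_k, S) → 0 as k → ∞. -/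
open Filter Set

/-- If the graph of `A` is closed, `w k ∈ A (x k)` with `w → y`, and `x` eventually stays in a bounded
set of a proper space, then the distance from `x k` to `A⁻¹(y)` tends to zero. -/
theorem tendsto_infDist_preimage_of_closedGraph {X Y : Type*} [PseudoMetricSpace X] [ProperSpace X]
    [TopologicalSpace Y] {A : X → Set Y} (hgraph : IsClosed {p : X × Y | p.2 ∈ A p.1})
    {x : ℕ → X} {w : ℕ → Y} {y : Y} {B : Set X} (hw : ∀ k, w k ∈ A (x k))
    (hwy : Tendsto w atTop (nhds y)) (hB : Bornology.IsBounded B) (hx : ∀ᶠ k in atTop, x k ∈ B) :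
    Tendsto (fun k => Metric.infDist (x k) {z | y ∈ A z}) atTop (nhds 0) := by
  refine tendsto_of_subseq_tendsto fun ns hns => ?_
  obtain ⟨a, -, φ, hφ, ha⟩ :=
    tendsto_subseq_of_frequently_bounded hB (hns.eventually hx).frequently
  have hya : y ∈ A a :=
    hgraph.mem_of_tendsto (ha.prodMk_nhds (hwy.comp (hns.comp hφ.tendsto_atTop)))
      (Eventually.of_forall fun k => hw (ns (φ k)))
  refine ⟨φ, ?_⟩
  have h := ((Metric.continuous_infDist_pt {z | y ∈ A z}).tendsto a).comp ha
  rwa [Metric.infDist_zero_of_mem (show a ∈ {z | y ∈ A z} from hya)] at h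

/-- R-class algorithm for `A : ℝⁿ ⇒ ℝⁿ` with closed graph and `A⁻¹`
locally bounded around `0`: if `w_k ∈ A(x_k)` with `‖w_k‖ ≤ α·ξ(k)^β`, `ξ(k) → 0`, and
the solution set `S = A⁻¹(0)` is nonempty, then `dist(x_k, S) → 0`. -/
theorem rClass_convergence_of_closedGraph_locBounded
    {n : ℕ} (A : EuclideanSpace ℝ (Fin n) → Set (EuclideanSpace ℝ (Fin n)))
    (hgraph : IsClosed {p : EuclideanSpace ℝ (Fin n) × EuclideanSpace ℝ (Fin n) |
      p.2 ∈ A p.1})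
    (hlb : ∃ σ₀ > (0 : ℝ), Bornology.IsBounded
      {z : EuclideanSpace ℝ (Fin n) | ∃ y : EuclideanSpace ℝ (Fin n), ‖y‖ ≤ σ₀ ∧ y ∈ A z})
    (S : Set (EuclideanSpace ℝ (Fin n)))
    (hSdef : S = {z | (0 : EuclideanSpace ℝ (Fin n)) ∈ A z}) (hSne : S.Nonempty)
    (x w : ℕ → EuclideanSpace ℝ (Fin n)) (hw : ∀ k, w k ∈ A (x k))
    (α β : ℝ) (hα : 0 < α) (hβ : 0 < β)
    (ξ : ℕ → ℝ) (hξ0 : ∀ k, 0 ≤ ξ k) (hξ : Tendsto ξ atTop (nhds 0))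
    (hwb : ∀ k, ‖w k‖ ≤ α * ξ k ^ β) :
    Tendsto (fun k => Metric.infDist (x k) S) atTop (nhds 0) := by
  subst hSdef
  obtain ⟨σ₀, hσ₀, hbdd⟩ := hlb
  have hbound : Tendsto (fun k => α * ξ k ^ β) atTop (nhds 0) := by
    have h := (hξ.rpow_const (Or.inr hβ.le)).const_mul α
    rwa [Real.zero_rpow hβ.ne', mul_zero] at h
  refine tendsto_infDist_preimage_of_closedGraph hgraph hw
    (squeeze_zero_norm hwb hbound) hbdd ?_
  filter_upwards [hbound.eventually_le_const hσ₀] with k hk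
  exact ⟨w k, (hwb k).trans hk, hw k⟩
end
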